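/- arXiv:1603.06087 — 4 statements merged into one kernel-verified Lean document; each statement's English description precedes it below -/
import Mathlib

section
/- Let p, q be integers with |p| ≥ 2 and |q| ≥ 3, let a be a real number, and let m, n be integers with |p| + 1 < m < 2|p| - 1 and 2n - 1 ≥ |q|. Then the self-affine set T(A, D) is connected if and only if either |q|(|q| − n) ≤ |a| ≤ q²(n−1)/(|q|−2) or |q| − n ≤ |a| ≤ |q|(n−1)/(|q|−2). -/
open Matrix

/-- The expanding matrix with rows `(p, 0)` and `(-a, q)`. -/
noncomputable def matA (p q : ℤ) (a : ℝ) : Matrix (Fin 2) (Fin 2) ℝ :=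
  !![(p : ℝ), 0; -a, (q : ℝ)]

/-- The product digit set `{0,…,m-1} × {0,…,n-1}` viewed inside `ℝ²`. -/
def digitSet (m n : ℤ) : Set (Fin 2 → ℝ) :=
  {v | ∃ i j : ℤ, 0 ≤ i ∧ i ≤ m - 1 ∧ 0 ≤ j ∧ j ≤ n - 1 ∧ v = ![(i : ℝ), (j : ℝ)]}

/-- `T(A, D) = { ∑_{k≥1} A^{-k} d_k : d_k ∈ D }`. -/
noncomputable def selfAffineSet (A : Matrix (Fin 2) (Fin 2) ℝ) (D : Set (Fin 2 → ℝ)) :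
    Set (Fin 2 → ℝ) :=
  {x | ∃ d : ℕ → (Fin 2 → ℝ), (∀ k, d k ∈ D) ∧
    HasSum (fun k => (A⁻¹ ^ (k + 1)).mulVec (d k)) x}

namespace SA

/-- digits as a finite type -/
abbrev Dg (m n : ℤ) := ↥(Set.Icc (0:ℤ) (m-1)) × ↥(Set.Icc (0:ℤ) (n-1))

/-- digit to vector -/
def vec {m n : ℤ} (e : Dg m n) : Fin 2 → ℝ := ![((e.1 : ℤ) : ℝ), ((e.2 : ℤ) : ℝ)]

/-- coding map -/
noncomputable def F (p q m n : ℤ) (a : ℝ) (d : ℕ → Dg m n) : Fin 2 → ℝ :=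
  ∑' k, ((matA p q a)⁻¹ ^ (k + 1)).mulVec (vec (d k))

/-- shift -/
def sh {α : Type*} (d : ℕ → α) : ℕ → α := fun k => d (k + 1)

/-- prepend -/
def cons {α : Type*} (e : α) (d : ℕ → α) : ℕ → α := fun k => Nat.casesOn k e d

lemma sh_cons {α : Type*} (e : α) (d : ℕ → α) : sh (cons e d) = d := rfl

lemma matA_mul {p q : ℤ} (a : ℝ) (hp : 4 ≤ |p|) (hq : 3 ≤ |q|) :
    matA p q a * !![1/(p:ℝ), 0; a/(p*q), 1/(q:ℝ)] = 1 := by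
  have hp0 : (p:ℝ) ≠ 0 := by
    have : p ≠ 0 := by rintro rfl; simp at hp
    exact_mod_cast this
  have hq0 : (q:ℝ) ≠ 0 := by
    have : q ≠ 0 := by rintro rfl; simp at hq
    exact_mod_cast this
  ext i j
  fin_cases i <;> fin_cases j <;> simp [matA, Matrix.mul_apply, Fin.sum_univ_two] <;> field_simp
  simp

lemma matA_inv {p q : ℤ} (a : ℝ) (hp : 4 ≤ |p|) (hq : 3 ≤ |q|) :
    (matA p q a)⁻¹ = !![1/(p:ℝ), 0; a/(p*q), 1/(q:ℝ)] :=
  Matrix.inv_eq_right_inv (matA_mul a hp hq)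

lemma pow_form {p q : ℤ} (a : ℝ) (hp : 4 ≤ |p|) (hq : 3 ≤ |q|) (k : ℕ) :
    ∃ c : ℝ, (matA p q a)⁻¹ ^ k = !![(1/(p:ℝ))^k, 0; c, (1/(q:ℝ))^k] ∧ |c| ≤ |a| * (1/2)^k := by
  have hpR : (4:ℝ) ≤ |(p:ℝ)| := by exact_mod_cast hp
  have hqR : (3:ℝ) ≤ |(q:ℝ)| := by exact_mod_cast hq
  induction k with
  | zero =>
    refine ⟨0, ?_, by simp⟩
    ext i j
    fin_cases i <;> fin_cases j <;> simp
  | succ k ih =>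
    obtain ⟨c, hc, hb⟩ := ih
    refine ⟨a/(p*q) * (1/(p:ℝ))^k + 1/(q:ℝ) * c, ?_, ?_⟩
    · rw [pow_succ', hc, matA_inv a hp hq]
      ext i j
      fin_cases i <;> fin_cases j <;> simp [Matrix.mul_apply, Fin.sum_univ_two] <;> ring
    · have h1 : |a/(p*q) * (1/(p:ℝ))^k| ≤ |a| / 12 * (1/2)^k := by
        rw [abs_mul, abs_div, abs_mul, abs_pow, abs_div, abs_one]
        gcongr
        · nlinarith
        · linarith
      have h2 : |1/(q:ℝ) * c| ≤ 1/3 * (|a| * (1/2)^k) := by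
        rw [abs_mul, abs_div, abs_one]
        gcongr
      have h3 := abs_add_le (a/(p*q) * (1/(p:ℝ))^k) (1/(q:ℝ) * c)
      have h4 : 0 ≤ |a| * (1/2:ℝ)^k := by positivity
      rw [pow_succ]
      nlinarith

lemma vec_bound {m n : ℤ} (e : Dg m n) (i : Fin 2) : |vec e i| ≤ |(m:ℝ)| + |(n:ℝ)| := by
  obtain ⟨⟨x, hx0, hx1⟩, ⟨y, hy0, hy1⟩⟩ := e
  have a1 : (0:ℝ) ≤ x := by exact_mod_cast hx0
  have a2 : (0:ℝ) ≤ y := by exact_mod_cast hy0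
  have a3 : (x:ℝ) ≤ m - 1 := by exact_mod_cast hx1
  have a4 : (y:ℝ) ≤ n - 1 := by exact_mod_cast hy1
  have := le_abs_self (m:ℝ)
  have := le_abs_self (n:ℝ)
  fin_cases i
  · simp [vec, abs_of_nonneg a1]; linarith [abs_nonneg (n:ℝ)]
  · simp [vec, abs_of_nonneg a2]; linarith [abs_nonneg (m:ℝ)]

lemma term_bound {p q m n : ℤ} (a : ℝ) (hp : 4 ≤ |p|) (hq : 3 ≤ |q|) (k : ℕ) (e : Dg m n) :
    ‖((matA p q a)⁻¹ ^ (k+1)).mulVec (vec e)‖ ≤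
      ((1 + |a|) * (|(m:ℝ)| + |(n:ℝ)|)) * (1/2)^(k+1) := by
  have hpR : (4:ℝ) ≤ |(p:ℝ)| := by exact_mod_cast hp
  have hqR : (3:ℝ) ≤ |(q:ℝ)| := by exact_mod_cast hq
  obtain ⟨c, hc, hb⟩ := pow_form (p := p) (q := q) a hp hq (k+1)
  have v0 := vec_bound e 0
  have v1 := vec_bound e 1
  set W := |(m:ℝ)| + |(n:ℝ)| with hW
  have hW0 : 0 ≤ W := by positivity
  have h2 : (0:ℝ) ≤ (1/2)^(k+1) := by positivity
  have e1 : |(1/(p:ℝ))^(k+1)| ≤ (1/2)^(k+1) := by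
    rw [abs_pow, abs_div, abs_one]; gcongr; linarith
  have e2 : |(1/(q:ℝ))^(k+1)| ≤ (1/2)^(k+1) := by
    rw [abs_pow, abs_div, abs_one]; gcongr; linarith
  rw [hc, pi_norm_le_iff_of_nonneg (by positivity)]
  intro i
  rw [Real.norm_eq_abs]
  fin_cases i
  · simp only [Fin.zero_eta, Matrix.mulVec, dotProduct, Fin.sum_univ_two]
    simp only [Matrix.of_apply, Matrix.cons_val_zero, Matrix.cons_val_one, zero_mul, add_zero]
    rw [abs_mul]
    have : |(1/(p:ℝ))^(k+1)| * |vec e 0| ≤ (1/2)^(k+1) * W := by gcongr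
    have : 0 ≤ |a| * W * (1/2)^(k+1) := by positivity
    nlinarith
  · simp only [Fin.mk_one, Matrix.mulVec, dotProduct, Fin.sum_univ_two]
    simp only [Matrix.of_apply, Matrix.cons_val_zero, Matrix.cons_val_one]
    refine (abs_add_le _ _).trans ?_
    rw [abs_mul, abs_mul]
    have : |c| * |vec e 0| ≤ |a| * (1/2)^(k+1) * W := by gcongr
    have : |(1/(q:ℝ))^(k+1)| * |vec e 1| ≤ (1/2)^(k+1) * W := by gcongr
    nlinarith

lemma summable_bound (C : ℝ) : Summable (fun k : ℕ => C * (1/2:ℝ)^(k+1)) := by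
  have := (summable_nat_add_iff 1).2 summable_geometric_two
  exact this.mul_left C

lemma summ {p q m n : ℤ} (a : ℝ) (hp : 4 ≤ |p|) (hq : 3 ≤ |q|) (d : ℕ → Dg m n) :
    Summable (fun k => ((matA p q a)⁻¹ ^ (k + 1)).mulVec (vec (d k))) :=
  Summable.of_norm_bounded (summable_bound _) (fun k => term_bound a hp hq k (d k))

lemma F_cont {p q m n : ℤ} (a : ℝ) (hp : 4 ≤ |p|) (hq : 3 ≤ |q|) :
    Continuous (F p q m n a) := by
  refine continuous_tsum (fun k => ?_) (summable_bound _) (fun k d => term_bound a hp hq k (d k))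
  have : Continuous (fun e : Dg m n => ((matA p q a)⁻¹ ^ (k + 1)).mulVec (vec e)) :=
    continuous_of_discreteTopology
  exact this.comp (continuous_apply k)

lemma F_bound {p q m n : ℤ} (a : ℝ) (hp : 4 ≤ |p|) (hq : 3 ≤ |q|) :
    ∃ C : ℝ, ∀ (d : ℕ → Dg m n) i, |F p q m n a d i| ≤ C := by
  refine ⟨∑' k : ℕ, ((1 + |a|) * (|(m:ℝ)| + |(n:ℝ)|)) * (1/2:ℝ)^(k+1), fun d i => ?_⟩
  refine (norm_le_pi_norm (F p q m n a d) i).trans ?_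
  exact tsum_of_norm_bounded (summable_bound _).hasSum (fun k => term_bound a hp hq k (d k))

lemma F_range {p q m n : ℤ} (a : ℝ) (hp : 4 ≤ |p|) (hq : 3 ≤ |q|) :
    selfAffineSet (matA p q a) (digitSet m n) = Set.range (F p q m n a) := by
  ext x
  constructor
  · rintro ⟨d, hd, hs⟩
    choose i j hi0 hi1 hj0 hj1 hv using hd
    refine ⟨fun k => (⟨i k, hi0 k, hi1 k⟩, ⟨j k, hj0 k, hj1 k⟩), ?_⟩
    have : (fun k => ((matA p q a)⁻¹ ^ (k + 1)).mulVec (d k)) = fun k =>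
      ((matA p q a)⁻¹ ^ (k + 1)).mulVec (vec ((⟨i k, hi0 k, hi1 k⟩, ⟨j k, hj0 k, hj1 k⟩) : Dg m n)) := by
      funext k; rw [hv k]; rfl
    rw [this] at hs
    exact hs.tsum_eq
  · rintro ⟨d, rfl⟩
    exact ⟨fun k => vec (d k), fun k => ⟨(d k).1, (d k).2, (d k).1.2.1, (d k).1.2.2, (d k).2.2.1,
      (d k).2.2.2, rfl⟩, (summ a hp hq d).hasSum⟩

lemma F_rec {p q m n : ℤ} (a : ℝ) (hp : 4 ≤ |p|) (hq : 3 ≤ |q|) (d : ℕ → Dg m n) :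
    F p q m n a d = (matA p q a)⁻¹.mulVec (vec (d 0) + F p q m n a (sh d)) := by
  have h := (summ a hp hq d).tsum_eq_zero_add
  have h2 : ∑' k, ((matA p q a)⁻¹ ^ (k + 1 + 1)).mulVec (vec (d (k+1)))
      = (matA p q a)⁻¹.mulVec (F p q m n a (sh d)) := by
    have hL := (summ a hp hq (sh d)).hasSum.mapL
      (LinearMap.toContinuousLinearMap (Matrix.mulVecLin (matA p q a)⁻¹))
    have := hL.tsum_eq
    simp only [LinearMap.coe_toContinuousLinearMap', Matrix.mulVecLin_apply, Matrix.mulVec_mulVec,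
      ← pow_succ'] at this
    exact this
  rw [Matrix.mulVec_add, ← h2]
  simpa [F] using h

lemma F_rec0 {p q m n : ℤ} (a : ℝ) (hp : 4 ≤ |p|) (hq : 3 ≤ |q|) (d : ℕ → Dg m n) :
    F p q m n a (sh d) 0 = p * F p q m n a d 0 - (d 0).1 ∧
    F p q m n a (sh d) 1 = q * F p q m n a d 1 - a * F p q m n a d 0 - (d 0).2 := by
  have h := F_rec a hp hq d
  have hA : (matA p q a) * (matA p q a)⁻¹ = 1 := by rw [matA_inv a hp hq]; exact matA_mul a hp hq
  have h2 : (matA p q a).mulVec (F p q m n a d) = vec (d 0) + F p q m n a (sh d) := by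
    rw [h, Matrix.mulVec_mulVec, hA, Matrix.one_mulVec]
  have h0 := congrFun h2 0
  have h1 := congrFun h2 1
  simp [matA, Matrix.mulVec, dotProduct, Fin.sum_univ_two, vec] at h0 h1
  constructor <;> linarith

lemma growth (r M : ℝ) (hr : 1 < |r|) (u : ℕ → ℝ) (C : ℝ) (hC : ∀ k, |u k| ≤ C)
    (h : ∀ k, |u (k+1) - r * u k| ≤ M) (k : ℕ) : (|r| - 1) * |u k| ≤ M := by
  by_contra! hcon
  have step : ∀ j, (|r|-1) * |u (k+j)| - M ≥ |r|^j * ((|r|-1) * |u k| - M) := by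
    intro j
    induction j with
    | zero => simp
    | succ j ih =>
      have h1 := h (k+j)
      have h2 : |r * u (k+j)| - |u (k+j+1)| ≤ M :=
        (abs_sub_abs_le_abs_sub _ _).trans (by rw [abs_sub_comm]; exact h1)
      rw [abs_mul] at h2
      have : |r| * ((|r|-1) * |u (k+j)| - M) ≥ |r| * (|r|^j * ((|r|-1) * |u k| - M)) :=
        mul_le_mul_of_nonneg_left ih (abs_nonneg r)
      rw [← add_assoc, pow_succ]
      nlinarith
  obtain ⟨j, hj⟩ := pow_unbounded_of_one_lt ((((|r|-1) * C - M)) / ((|r|-1) * |u k| - M)) hr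
  rw [div_lt_iff₀ (by linarith)] at hj
  have := step j
  have h3 : (|r|-1) * |u (k+j)| ≤ (|r|-1) * C := mul_le_mul_of_nonneg_left (hC _) (by linarith)
  linarith

end SA
namespace SA

lemma dig_diff {m n : ℤ} (e e' : Dg m n) :
    |(e.1:ℤ) - (e'.1:ℤ)| ≤ m - 1 ∧ |(e.2:ℤ) - (e'.2:ℤ)| ≤ n - 1 := by
  obtain ⟨⟨x, hx0, hx1⟩, ⟨y, hy0, hy1⟩⟩ := e
  obtain ⟨⟨x', hx0', hx1'⟩, ⟨y', hy0', hy1'⟩⟩ := e'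
  simp only [abs_le]
  omega

lemma exists_dig {m n i j : ℤ} (hi : |i| ≤ m - 1) (hj : |j| ≤ n - 1) :
    ∃ e e' : Dg m n, (e.1:ℤ) - (e'.1:ℤ) = i ∧ (e.2:ℤ) - (e'.2:ℤ) = j := by
  rw [abs_le] at hi hj
  refine ⟨(⟨max i 0, by constructor <;> omega⟩, ⟨max j 0, by constructor <;> omega⟩),
    (⟨max (-i) 0, by constructor <;> omega⟩, ⟨max (-j) 0, by constructor <;> omega⟩), ?_, ?_⟩
  · simp only; omega
  · simp only; omega

lemma necessary {p q m n : ℤ} {a : ℝ} (hp : 4 ≤ |p|) (hq : 3 ≤ |q|) (hm2 : m < 2 * |p| - 1)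
    (d d' : ℕ → Dg m n) (h : F p q m n a d = F p q m n a d') (s t : ℤ)
    (hs : ((d 0).1:ℤ) - ((d' 0).1:ℤ) = s) (ht : ((d 0).2:ℤ) - ((d' 0).2:ℤ) = t) :
    |s| ≤ 1 ∧ (|(q:ℝ)| - 1) * |(q:ℝ) * t - a * s| ≤ |(q:ℝ)| * (n - 1) + |a| := by
  have hpR : (4:ℝ) ≤ |(p:ℝ)| := by exact_mod_cast hp
  have hqR : (3:ℝ) ≤ |(q:ℝ)| := by exact_mod_cast hq
  obtain ⟨C, hC⟩ := F_bound (p := p) (q := q) (m := m) (n := n) a hp hq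
  set X : ℕ → ℝ := fun k => F p q m n a (sh^[k+1] d) 0 - F p q m n a (sh^[k+1] d') 0 with hX
  set Y : ℕ → ℝ := fun k => F p q m n a (sh^[k+1] d) 1 - F p q m n a (sh^[k+1] d') 1 with hY
  have hX0 : X 0 = -s := by
    have h1 := (F_rec0 a hp hq d).1
    have h2 := (F_rec0 a hp hq d').1
    rw [← hs]; push_cast
    simp only [hX, zero_add, Function.iterate_one, h1, h2, h]; ring
  have hY0 : Y 0 = -t := by
    have h1 := (F_rec0 a hp hq d).2
    have h2 := (F_rec0 a hp hq d').2
    rw [← ht]; push_cast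
    simp only [hY, zero_add, Function.iterate_one, h1, h2, h]; ring
  have hstep : ∀ k, ∃ i j : ℤ, |i| ≤ m - 1 ∧ |j| ≤ n - 1 ∧ X (k+1) = p * X k - i ∧
      Y (k+1) = q * Y k - a * X k - j := by
    intro k
    have h1 := F_rec0 a hp hq (sh^[k+1] d)
    have h2 := F_rec0 a hp hq (sh^[k+1] d')
    have hd := dig_diff ((sh^[k+1] d) 0) ((sh^[k+1] d') 0)
    refine ⟨_, _, hd.1, hd.2, ?_, ?_⟩
    · simp only [hX, Function.iterate_succ_apply' sh (k+1), h1.1, h2.1]; push_cast; ring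
    · simp only [hX, hY, Function.iterate_succ_apply' sh (k+1), h1.2, h2.2]; push_cast; ring
  have hXb : ∀ k, |X k| ≤ C + C := fun k => (abs_sub _ _).trans (add_le_add (hC _ _) (hC _ _))
  have hYb : ∀ k, |Y k| ≤ C + C := fun k => (abs_sub _ _).trans (add_le_add (hC _ _) (hC _ _))
  have hgX := growth p (m-1) (by linarith) X _ hXb (fun k => by
    obtain ⟨i, j, hi, hj, e1, e2⟩ := hstep k
    rw [e1, sub_sub_cancel_left, abs_neg]; exact_mod_cast hi)
  have hXint : ∀ k, ∃ z : ℤ, X k = z := by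
    intro k
    induction k with
    | zero => exact ⟨-s, by rw [hX0]; push_cast; ring⟩
    | succ k ih =>
      obtain ⟨z, hz⟩ := ih
      obtain ⟨i, j, hi, hj, e1, e2⟩ := hstep k
      exact ⟨p * z - i, by rw [e1, hz]; push_cast; ring⟩
  have hm2R : (m:ℝ) < 2 * |(p:ℝ)| - 1 := by exact_mod_cast hm2
  have hX1 : ∀ k, |X k| ≤ 1 := by
    intro k
    obtain ⟨z, hz⟩ := hXint k
    have h1 := hgX k
    have h2 : |X k| < 2 := by
      by_contra! h2
      nlinarith
    rw [hz] at h2 ⊢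
    have h3 : |z| < 2 := by exact_mod_cast h2
    have : |z| ≤ 1 := by omega
    exact_mod_cast this
  have hgY := growth q (|a| + (n-1)) (by linarith) Y _ hYb (fun k => by
    obtain ⟨i, j, hi, hj, e1, e2⟩ := hstep k
    have hjR : |(j:ℝ)| ≤ n - 1 := by exact_mod_cast hj
    have : Y (k+1) - q * Y k = -(a * X k) - j := by rw [e2]; ring
    rw [this]
    refine (abs_sub _ _).trans ?_
    rw [abs_neg, abs_mul]
    have := mul_le_mul_of_nonneg_left (hX1 k) (abs_nonneg a)
    linarith)
  constructor
  · have := hX1 0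
    rw [hX0, abs_neg] at this
    exact_mod_cast this
  · obtain ⟨i, j, hi, hj, e1, e2⟩ := hstep 0
    have hjR : |(j:ℝ)| ≤ n - 1 := by exact_mod_cast hj
    have h1 := hgY 1
    rw [hY0, hX0, zero_add] at e2
    have : (q:ℝ) * t - a * s = -(Y 1) - j := by rw [e2]; ring
    rw [this]
    have h3 := abs_sub (-(Y 1)) (j:ℝ)
    rw [abs_neg] at h3
    have := mul_le_mul_of_nonneg_left h3 (by linarith : 0 ≤ |(q:ℝ)| - 1)
    nlinarith

/-- rounding to an integer of bounded size -/
lemma clamp (r z : ℝ) (M : ℤ) (hM : 0 ≤ M) (hr : 1/2 ≤ r) (hz : |z| ≤ M + r) :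
    ∃ j : ℤ, |j| ≤ M ∧ |z - j| ≤ r := by
  have hMR : (0:ℝ) ≤ M := by exact_mod_cast hM
  rw [abs_le] at hz
  by_cases h1 : z ≤ -M
  · refine ⟨-M, by rw [abs_neg, abs_of_nonneg hM], ?_⟩
    rw [abs_le]; push_cast; constructor <;> linarith
  by_cases h2 : (M:ℝ) ≤ z
  · refine ⟨M, by rw [abs_of_nonneg hM], ?_⟩
    rw [abs_le]; constructor <;> linarith
  push Not at h1 h2
  refine ⟨round z, ?_, (abs_sub_round z).trans hr⟩
  have h3 := abs_sub_round z
  rw [abs_le] at h3 ⊢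
  constructor
  · have : ((-M - 1 : ℤ):ℝ) < round z := by push_cast; linarith
    have : -M - 1 < round z := by exact_mod_cast this
    omega
  · have : (round z : ℝ) < ((M + 1 : ℤ):ℝ) := by push_cast; linarith
    have : round z < M + 1 := by exact_mod_cast this
    omega

/-- radius -/
noncomputable def Rad (q n : ℤ) (a : ℝ) : ℝ := (|(q:ℝ)| * (n - 1) + |a|) / (|(q:ℝ)| - 1)

lemma cover {q n : ℤ} {a : ℝ} (hq : 3 ≤ |q|) (hn : |q| ≤ 2 * n - 1)
    (ha : |a| * (|(q:ℝ)| - 2) ≤ |(q:ℝ)| ^ 2 * (n - 1)) (z : ℝ) (hz : |z| ≤ Rad q n a) :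
    ∃ j s : ℤ, |j| ≤ n - 1 ∧ |s| ≤ 1 ∧ |(q:ℝ) * (z - j) - a * s| ≤ Rad q n a := by
  have hqR : (3:ℝ) ≤ |(q:ℝ)| := by exact_mod_cast hq
  have hnR : |(q:ℝ)| ≤ 2 * n - 1 := by exact_mod_cast hn
  have hq0 : (q:ℝ) ≠ 0 := by intro h; rw [h, abs_zero] at hqR; linarith
  set Q := |(q:ℝ)| with hQ
  set r := Rad q n a / Q with hr
  have hQ1 : 0 < Q - 1 := by linarith
  have hQ0 : 0 < Q := by linarith
  have hRr : Rad q n a = Q * r := by rw [hr]; field_simp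
  have hdef : (Q - 1) * (Q * r) = Q * (n-1) + |a| := by
    rw [← hRr, Rad, ← hQ]; field_simp
  have hb : |a / q| = |a| / Q := abs_div _ _
  set b := |a| / Q with hbdef
  have hab : |a| = Q * b := by rw [hbdef]; field_simp
  have hb0 : 0 ≤ b := by positivity
  rw [hab] at ha
  have hdef2 : (Q - 1) * r = (n-1) + b := by
    have : Q * ((Q - 1) * r) = Q * ((n-1) + b) := by rw [hab] at hdef; linarith
    exact mul_left_cancel₀ hQ0.ne' this
  have ha2 : b * (Q - 2) ≤ Q * (n-1) := by
    have : Q * (b * (Q - 2)) ≤ Q * (Q * (n-1)) := by nlinarith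
    exact le_of_mul_le_mul_left this hQ0
  have hr2 : 1/2 ≤ r := by
    by_contra! h
    nlinarith
  have key : ∃ s : ℤ, |s| ≤ 1 ∧ |z - a / q * s| ≤ ((n-1 : ℤ):ℝ) + r := by
    push_cast
    have hR2 : Q * r = (n - 1) + r + b := by linarith
    rw [hRr, hR2] at hz
    have hbig : b ≤ 2 * ((n-1) + r) := by
      have : (Q-1) * b ≤ (Q - 1) * (2 * ((n-1) + r)) := by nlinarith
      exact le_of_mul_le_mul_left this hQ1
    by_cases hmid : |z| ≤ (n-1) + r
    · exact ⟨0, by simp, by simpa using hmid⟩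
    push Not at hmid
    -- sign choice
    rw [← hb] at hz hbig
    rcases abs_cases z with ⟨h1, h1'⟩ | ⟨h1, h1'⟩ <;> rcases abs_cases (a/q) with ⟨h2, h2'⟩ | ⟨h2, h2'⟩
    · exact ⟨1, by simp, by rw [abs_le]; push_cast; constructor <;> linarith⟩
    · exact ⟨-1, by simp, by rw [abs_le]; push_cast; constructor <;> linarith⟩
    · exact ⟨-1, by simp, by rw [abs_le]; push_cast; constructor <;> linarith⟩
    · exact ⟨1, by simp, by rw [abs_le]; push_cast; constructor <;> linarith⟩
  obtain ⟨s, hs, hs2⟩ := key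
  obtain ⟨j, hj, hj2⟩ := clamp r _ (n-1) (by omega) hr2 hs2
  refine ⟨j, s, hj, hs, ?_⟩
  have : (q:ℝ) * (z - j) - a * s = q * (z - a / q * s - j) := by field_simp; ring
  rw [this, abs_mul, hRr]
  exact mul_le_mul_of_nonneg_left hj2 (abs_nonneg _)

lemma sufficient {p q m n : ℤ} {a : ℝ} (hp : 4 ≤ |p|) (hq : 3 ≤ |q|) (hm1 : |p| + 1 < m)
    (hn : |q| ≤ 2 * n - 1)
    (ha : |a| * (|(q:ℝ)| - 2) ≤ |(q:ℝ)| ^ 2 * (n - 1)) (e e' : Dg m n) (s t : ℤ)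
    (hs : (e.1:ℤ) - (e'.1:ℤ) = s) (ht : (e.2:ℤ) - (e'.2:ℤ) = t) (hs1 : |s| ≤ 1)
    (hst : |(q:ℝ) * t - a * s| ≤ Rad q n a) :
    ∃ d d' : ℕ → Dg m n, F p q m n a (cons e d) = F p q m n a (cons e' d') := by
  have hpR : (4:ℝ) ≤ |(p:ℝ)| := by exact_mod_cast hp
  have hqR : (3:ℝ) ≤ |(q:ℝ)| := by exact_mod_cast hq
  let St := {x : ℤ × ℝ // |x.1| ≤ 1 ∧ |(q:ℝ) * x.2 - a * x.1| ≤ Rad q n a}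
  have hstep : ∀ x : St, ∃ (e e' : Dg m n) (y : St), y.1.1 = p * x.1.1 - ((e.1:ℤ) - (e'.1:ℤ)) ∧
      y.1.2 = q * x.1.2 - a * x.1.1 - ((e.2:ℤ) - (e'.2:ℤ)) := by
    rintro ⟨⟨s, u⟩, h1, h2⟩
    obtain ⟨j, s', hj, hs', h3⟩ := cover hq hn ha _ h2
    have hi : |p * s - s'| ≤ m - 1 := by
      have h4 := abs_sub (p * s) s'
      rw [abs_mul] at h4
      simp only at h1
      nlinarith [abs_nonneg p]
    obtain ⟨e, e', g1, g2⟩ := exists_dig hi hj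
    refine ⟨e, e', ⟨(s', q * u - a * s - j), hs', h3⟩, ?_, ?_⟩
    · simp only [g1]; ring
    · simp only [← g2]; push_cast; ring
  choose g g' nx hn1 hn2 using hstep
  let x0 : St := ⟨(-s, -(t:ℝ)), by rw [abs_neg]; exact hs1, by
    have : (q:ℝ) * (-(t:ℝ)) - a * ((-s : ℤ):ℝ) = -(q * t - a * s) := by push_cast; ring
    simp only
    rw [this, abs_neg]; exact hst⟩
  let x : ℕ → St := fun k => nx^[k] x0
  have hx : ∀ k, x (k+1) = nx (x k) := fun k => Function.iterate_succ_apply' nx k x0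
  let d : ℕ → Dg m n := fun k => g (x k)
  let d' : ℕ → Dg m n := fun k => g' (x k)
  have shd : ∀ (w : ℕ → Dg m n) k, (sh^[k] w) 0 = w k := by
    intro w k
    induction k generalizing w with
    | zero => rfl
    | succ k ih => rw [Function.iterate_succ_apply, ih]; rfl
  obtain ⟨C, hC⟩ := F_bound (p := p) (q := q) (m := m) (n := n) a hp hq
  set X : ℕ → ℝ := fun k => F p q m n a (sh^[k] d) 0 - F p q m n a (sh^[k] d') 0 - (x k).1.1 with hX
  set Y : ℕ → ℝ := fun k => F p q m n a (sh^[k] d) 1 - F p q m n a (sh^[k] d') 1 - (x k).1.2 with hY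
  have hXs : ∀ k, X (k+1) = p * X k := by
    intro k
    have h1 := (F_rec0 a hp hq (sh^[k] d)).1
    have h2 := (F_rec0 a hp hq (sh^[k] d')).1
    rw [shd] at h1 h2
    have h3 : ((x (k+1)).1.1 : ℝ) = p * (x k).1.1 - ((((d k).1:ℤ):ℝ) - (((d' k).1:ℤ):ℝ)) := by
      rw [hx, hn1]; push_cast; rfl
    simp only [hX, Function.iterate_succ_apply' sh k, h1, h2, h3]; ring
  have hYs : ∀ k, Y (k+1) = q * Y k - a * X k := by
    intro k
    have h1 := (F_rec0 a hp hq (sh^[k] d)).2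
    have h2 := (F_rec0 a hp hq (sh^[k] d')).2
    rw [shd] at h1 h2
    have h3 : (x (k+1)).1.2 = q * (x k).1.2 - a * (x k).1.1 -
        ((((d k).2:ℤ):ℝ) - (((d' k).2:ℤ):ℝ)) := by
      rw [hx, hn2]
    simp only [hX, hY, Function.iterate_succ_apply' sh k, h1, h2, h3]; ring
  have hXb : ∀ k, |X k| ≤ C + C + 1 := by
    intro k
    refine (abs_sub _ _).trans (add_le_add ((abs_sub _ _).trans (add_le_add (hC _ _) (hC _ _))) ?_)
    exact_mod_cast (x k).2.1
  have hYb : ∀ k, |Y k| ≤ C + C + (Rad q n a + |a|) := by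
    intro k
    refine (abs_sub _ _).trans (add_le_add ((abs_sub _ _).trans (add_le_add (hC _ _) (hC _ _))) ?_)
    have h1 := (x k).2.2
    have h2 : |(((x k).1.1 : ℤ) : ℝ)| ≤ 1 := by exact_mod_cast (x k).2.1
    have h3 : |(q:ℝ) * (x k).1.2| ≤ Rad q n a + |a| := by
      have h5 : (q:ℝ) * (x k).1.2 = (q * (x k).1.2 - a * (x k).1.1) + a * (x k).1.1 := by ring
      rw [h5]
      refine (abs_add_le _ _).trans (add_le_add h1 ?_)
      rw [abs_mul]
      nlinarith [abs_nonneg a]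
    rw [abs_mul] at h3
    nlinarith [abs_nonneg (x k).1.2]
  have hX0 : ∀ k, X k = 0 := by
    intro k
    have := growth p 0 (by linarith) X _ hXb (fun k => by rw [hXs]; simp) k
    have : |X k| ≤ 0 := by
      by_contra! h; nlinarith
    exact abs_nonpos_iff.1 this
  have hY0 : ∀ k, Y k = 0 := by
    intro k
    have := growth q 0 (by linarith) Y _ hYb (fun k => by rw [hYs, hX0]; simp) k
    have : |Y k| ≤ 0 := by
      by_contra! h; nlinarith
    exact abs_nonpos_iff.1 this
  refine ⟨d, d', ?_⟩
  rw [F_rec a hp hq (cons e d), F_rec a hp hq (cons e' d')]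
  congr 1
  have hx1 : F p q m n a d 0 - F p q m n a d' 0 = -s := by
    have h9 := hX0 0
    simp only [hX, Function.iterate_zero, id, x, x0] at h9
    push_cast at h9
    linarith
  have hy1 : F p q m n a d 1 - F p q m n a d' 1 = -t := by
    have h9 := hY0 0
    simp only [hY, Function.iterate_zero, id, x, x0] at h9
    linarith
  rw [← hs] at hx1
  rw [← ht] at hy1
  push_cast at hx1 hy1
  rw [sh_cons, sh_cons]
  ext i
  fin_cases i
  · simp [vec, cons]; linarith
  · simp [vec, cons]; linarith

end SA
namespace SA

lemma disconn {p q m n : ℤ} {a : ℝ} (hp : 4 ≤ |p|) (hq : 3 ≤ |q|)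
    (hT : IsPreconnected (Set.range (F p q m n a))) (P : Dg m n → Prop) (e e' : Dg m n)
    (he : P e) (he' : ¬ P e') :
    ∃ d d' : ℕ → Dg m n, P (d 0) ∧ ¬ P (d' 0) ∧ F p q m n a d = F p q m n a d' := by
  have hcl : ∀ S : Set (Dg m n), IsClosed (F p q m n a '' {d | d 0 ∈ S}) := by
    intro S
    have h1 : IsClosed {d : ℕ → Dg m n | d 0 ∈ S} :=
      (isClosed_discrete S).preimage (continuous_apply 0)
    exact (h1.isCompact.image (F_cont a hp hq)).isClosed
  have h := isPreconnected_closed_iff.1 hT _ _ (hcl {x | P x}) (hcl {x | ¬ P x}) ?_ ?_ ?_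
  · obtain ⟨x, -, ⟨d, hd, rfl⟩, ⟨d', hd', h2⟩⟩ := h
    exact ⟨d, d', hd, hd', h2.symm⟩
  · rintro _ ⟨d, rfl⟩
    by_cases h : P (d 0)
    · exact Or.inl ⟨d, h, rfl⟩
    · exact Or.inr ⟨d, h, rfl⟩
  · exact ⟨_, ⟨fun _ => e, rfl⟩, ⟨fun _ => e, he, rfl⟩⟩
  · exact ⟨_, ⟨fun _ => e', rfl⟩, ⟨fun _ => e', he', rfl⟩⟩

lemma cons_eta {α : Type*} (d : ℕ → α) : cons (d 0) (sh d) = d := by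
  funext k; cases k <;> rfl

lemma level {p q m n : ℤ} {a : ℝ} (hp : 4 ≤ |p|) (hq : 3 ≤ |q|)
    (H : ∀ P : Dg m n → Prop, (∀ e e' : Dg m n, (∃ d d' : ℕ → Dg m n,
      F p q m n a (cons e d) = F p q m n a (cons e' d')) → (P e ↔ P e')) → ∀ e e', P e ↔ P e')
    (k : ℕ) : ∀ (g : (Fin 2 → ℝ) → Prop),
      (∀ d d' : ℕ → Dg m n, (∀ i < k, d i = d' i) → (g (F p q m n a d) ↔ g (F p q m n a d'))) →
      ∀ d d' : ℕ → Dg m n, g (F p q m n a d) ↔ g (F p q m n a d') := by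
  induction k with
  | zero => intro g hg d d'; exact hg d d' (by simp)
  | succ k ih =>
    intro g hg d d'
    have hF : ∀ (e : Dg m n) d, F p q m n a (cons e d) =
        (matA p q a)⁻¹.mulVec (vec e + F p q m n a d) := fun e d => F_rec a hp hq (cons e d)
    have h1 : ∀ (e : Dg m n) d d', g (F p q m n a (cons e d)) ↔ g (F p q m n a (cons e d')) := by
      intro e d d'
      have := ih (fun x => g ((matA p q a)⁻¹.mulVec (vec e + x))) (by
        intro d d' hdd
        simp only [← hF]
        apply hg
        intro i hi
        cases i with
        | zero => rfl
        | succ i => exact hdd i (by omega)) d d'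
      simpa only [← hF] using this
    have h2 := H (fun e => g (F p q m n a (cons e (fun _ => e)))) (by
      rintro e e' ⟨d, d', hd⟩
      rw [h1 e _ d, h1 e' _ d', hd]) (d 0) (d' 0)
    rw [← cons_eta d, ← cons_eta d', h1 (d 0) _ (fun _ => d 0), h1 (d' 0) _ (fun _ => d' 0)]
    exact h2

lemma conn {p q m n : ℤ} {a : ℝ} (hp : 4 ≤ |p|) (hq : 3 ≤ |q|)
    (H : ∀ P : Dg m n → Prop, (∀ e e' : Dg m n, (∃ d d' : ℕ → Dg m n,
      F p q m n a (cons e d) = F p q m n a (cons e' d')) → (P e ↔ P e')) → ∀ e e', P e ↔ P e') :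
    IsPreconnected (Set.range (F p q m n a)) := by
  rw [isPreconnected_closed_iff]
  rintro U V hU hV hUV ⟨_, ⟨d, rfl⟩, hdU⟩ ⟨_, ⟨d', rfl⟩, hdV⟩
  by_contra hne
  have hdis : ∀ w, ¬ (F p q m n a w ∈ U ∧ F p q m n a w ∈ V) := fun w hw =>
    hne ⟨_, ⟨w, rfl⟩, hw⟩
  let _ : MetricSpace (ℕ → Dg m n) := PiNat.metricSpace
  have hc := F_cont (p := p) (q := q) (m := m) (n := n) a hp hq
  have hdj : Disjoint (F p q m n a ⁻¹' U) (F p q m n a ⁻¹' V) :=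
    Set.disjoint_left.2 fun w h1 h2 => hdis w ⟨h1, h2⟩
  obtain ⟨δ, hδ, hth⟩ := hdj.exists_thickenings (hU.preimage hc).isCompact (hV.preimage hc)
  obtain ⟨k, hk⟩ := exists_pow_lt_of_lt_one hδ (by norm_num : (1/2:ℝ) < 1)
  have key : ∀ w w' : ℕ → Dg m n, (∀ i < k, w i = w' i) → F p q m n a w ∈ U →
      F p q m n a w' ∈ U := by
    intro w w' hw hwU
    have hdist : dist w' w < δ := by
      refine lt_of_le_of_lt ?_ hk
      exact PiNat.mem_cylinder_iff_dist_le.1 (fun i hi => (hw i hi).symm)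
    rcases hUV ⟨w', rfl⟩ with h | h
    · exact h
    · exfalso
      have hm : w' ∈ Metric.thickening δ (F p q m n a ⁻¹' U) :=
        Metric.mem_thickening_iff.2 ⟨w, hwU, hdist⟩
      exact Set.disjoint_left.1 hth hm (Metric.self_subset_thickening hδ _ h)
  have := level hp hq H k (fun x => x ∈ U) (fun w w' hw =>
    ⟨key w w' hw, key w' w (fun i hi => (hw i hi).symm)⟩) d d'
  exact hdis d' ⟨this.1 hdU, hdV⟩

lemma rad_iff {q n : ℤ} {a : ℝ} (hq : 3 ≤ |q|) (x : ℝ) :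
    x ≤ Rad q n a ↔ (|(q:ℝ)| - 1) * x ≤ |(q:ℝ)| * (n - 1) + |a| := by
  have hqR : (3:ℝ) ≤ |(q:ℝ)| := by exact_mod_cast hq
  rw [Rad, le_div_iff₀ (by linarith), mul_comm]

/-- from local constancy on `ℤ`-intervals -/
lemma int_const (N : ℤ) (f : ℤ → Prop) (h : ∀ j, 0 ≤ j → j + 1 ≤ N → (f j ↔ f (j+1))) (j : ℤ)
    (h0 : 0 ≤ j) (hj : j ≤ N) : f 0 ↔ f j := by
  lift j to ℕ using h0
  induction j with
  | zero => rfl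
  | succ j ih =>
    push_cast at hj ⊢
    exact (ih (by omega)).trans (h j (by omega) hj)

lemma backward {p q m n : ℤ} {a : ℝ} (hp : 4 ≤ |p|) (hq : 3 ≤ |q|)
    (hm1 : |p| + 1 < m) (hn : |q| ≤ 2 * n - 1)
    (h : (|(q:ℝ)| * (|(q:ℝ)| - n) ≤ |a| ∧ |a| * (|(q:ℝ)| - 2) ≤ |(q:ℝ)|^2 * (n-1)) ∨
      (|(q:ℝ)| - n ≤ |a| ∧ |a| * (|(q:ℝ)| - 2) ≤ |(q:ℝ)| * (n-1))) :
    IsPreconnected (Set.range (F p q m n a)) := by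
  have hqR : (3:ℝ) ≤ |(q:ℝ)| := by exact_mod_cast hq
  have hnR : |(q:ℝ)| ≤ 2 * n - 1 := by exact_mod_cast hn
  have hn2 : (2:ℝ) ≤ n := by linarith
  have ha : |a| * (|(q:ℝ)| - 2) ≤ |(q:ℝ)| ^ 2 * (n - 1) := by
    rcases h with h | h
    · exact h.2
    · refine h.2.trans ?_
      have : |(q:ℝ)| * (n-1) ≥ 0 := by nlinarith
      nlinarith
  refine conn hp hq fun P hP => ?_
  -- edges
  have edge : ∀ e e' : Dg m n, ∀ s t : ℤ, |s| ≤ 1 →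
      (|(q:ℝ)| - 1) * |(q:ℝ) * t - a * s| ≤ |(q:ℝ)| * (n - 1) + |a| →
      (e.1:ℤ) - (e'.1:ℤ) = s → (e.2:ℤ) - (e'.2:ℤ) = t → (P e ↔ P e') := by
    intro e e' s t hs hst h1 h2
    exact hP e e' (sufficient hp hq hm1 hn ha e e' s t h1 h2 hs ((rad_iff hq _).2 hst))
  -- extend P to integers
  let f : ℤ → ℤ → Prop := fun i j => ∃ (hi : i ∈ Set.Icc (0:ℤ) (m-1)) (hj : j ∈ Set.Icc (0:ℤ) (n-1)),
    P (⟨i, hi⟩, ⟨j, hj⟩)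
  have hf : ∀ i j (hi : i ∈ Set.Icc (0:ℤ) (m-1)) (hj : j ∈ Set.Icc (0:ℤ) (n-1)),
      f i j ↔ P (⟨i, hi⟩, ⟨j, hj⟩) := fun i j hi hj => ⟨fun ⟨_, _, h⟩ => h, fun h => ⟨hi, hj, h⟩⟩
  have edge' : ∀ i j i' j' : ℤ, 0 ≤ i → i ≤ m - 1 → 0 ≤ j → j ≤ n - 1 → 0 ≤ i' → i' ≤ m - 1 →
      0 ≤ j' → j' ≤ n - 1 → ∀ s t : ℤ, |s| ≤ 1 →
      (|(q:ℝ)| - 1) * |(q:ℝ) * t - a * s| ≤ |(q:ℝ)| * (n - 1) + |a| →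
      i - i' = s → j - j' = t → (f i j ↔ f i' j') := by
    intro i j i' j' h1 h2 h3 h4 h5 h6 h7 h8 s t hs hst h9 h10
    rw [hf i j ⟨h1, h2⟩ ⟨h3, h4⟩, hf i' j' ⟨h5, h6⟩ ⟨h7, h8⟩]
    exact edge _ _ s t hs hst h9 h10
  have hm0 : 0 ≤ m - 1 := by omega
  have hn0 : 0 ≤ n - 1 := by omega
  suffices hall : ∀ i j, 0 ≤ i → i ≤ m - 1 → 0 ≤ j → j ≤ n - 1 → (f 0 0 ↔ f i j) by
    rintro ⟨⟨i, hi⟩, ⟨j, hj⟩⟩ ⟨⟨i', hi'⟩, ⟨j', hj'⟩⟩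
    rw [← hf i j hi hj, ← hf i' j' hi' hj', ← hall i j hi.1 hi.2 hj.1 hj.2,
      ← hall i' j' hi'.1 hi'.2 hj'.1 hj'.2]
  rcases h with ⟨h1, h2⟩ | ⟨h1, h2⟩
  · -- vertical edges and one slanted edge
    have hvert : ∀ i j, 0 ≤ i → i ≤ m - 1 → 0 ≤ j → j ≤ n - 1 → (f i 0 ↔ f i j) := by
      intro i j hi0 hi1 hj0 hj1
      refine int_const (n-1) (f i) (fun j hj hj' => ?_) j hj0 hj1
      refine edge' i j i (j+1) hi0 hi1 hj (by omega) hi0 hi1 (by omega) hj' 0 (-1) (by simp) ?_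
        (by omega) (by omega)
      have : |(q:ℝ) * ((-1:ℤ):ℝ) - a * ((0:ℤ):ℝ)| = |(q:ℝ)| := by
        push_cast; rw [mul_zero, sub_zero, mul_neg_one, abs_neg]
      rw [this]; nlinarith
    have hq0 : (q:ℝ) ≠ 0 := by intro h; rw [h, abs_zero] at hqR; linarith
    obtain ⟨t, ht, htt⟩ : ∃ t : ℤ, |t| ≤ n - 1 ∧ |a / q - t| ≤ Rad q n a / |(q:ℝ)| := by
      refine clamp _ _ _ hn0 ?_ ?_
      · rw [le_div_iff₀ (by linarith), rad_iff hq]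
        nlinarith [abs_nonneg a]
      · rw [abs_div, ← sub_le_iff_le_add', le_div_iff₀ (by linarith), sub_mul,
          div_mul_cancel₀ _ (abs_pos.2 hq0).ne', rad_iff hq]
        push_cast
        nlinarith
    have htR : (|(q:ℝ)| - 1) * |(q:ℝ) * ((-t : ℤ):ℝ) - a * ((-1:ℤ):ℝ)| ≤ |(q:ℝ)| * (n - 1) + |a| := by
      rw [← rad_iff hq]
      have e1 : (q:ℝ) * ((-t : ℤ):ℝ) - a * ((-1:ℤ):ℝ) = q * (a / q - t) := by
        push_cast; field_simp; ring
      rw [e1, abs_mul]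
      rw [le_div_iff₀ (by linarith)] at htt
      linarith
    rw [abs_le] at ht
    have hhor : ∀ i, 0 ≤ i → i ≤ m - 1 → (f 0 0 ↔ f i 0) := by
      intro i hi0 hi1
      refine int_const (m-1) (fun i => f i 0) (fun i hi hi' => ?_) i hi0 hi1
      rw [hvert i (max 0 (-t)) hi (by omega) (by omega) (by omega),
        hvert (i+1) (max 0 (-t) + t) (by omega) hi' (by omega) (by omega)]
      exact edge' _ _ _ _ hi (by omega) (by omega) (by omega) (by omega) hi' (by omega) (by omega)
        (-1) (-t) (by simp) htR (by omega) (by omega)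
    intro i j hi0 hi1 hj0 hj1
    exact (hhor i hi0 hi1).trans (hvert i j hi0 hi1 hj0 hj1)
  · have hhor : ∀ i j, 0 ≤ i → i ≤ m - 1 → 0 ≤ j → j ≤ n - 1 → (f 0 j ↔ f i j) := by
      intro i j hi0 hi1 hj0 hj1
      refine int_const (m-1) (fun i => f i j) (fun i hi hi' => ?_) i hi0 hi1
      refine edge' i j (i+1) j hi (by omega) hj0 hj1 (by omega) hi' hj0 hj1 (-1) 0 (by simp) ?_
        (by omega) (by omega)
      have : |(q:ℝ) * ((0:ℤ):ℝ) - a * ((-1:ℤ):ℝ)| = |a| := by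
        push_cast; rw [mul_zero, mul_neg_one, zero_sub, neg_neg]
      rw [this]; linarith
    have hqa : ∃ σ : ℤ, |σ| = 1 ∧ |(q:ℝ) * ((1:ℤ):ℝ) - a * (σ:ℝ)| = abs (|(q:ℝ)| - |a|) := by
      rcases abs_cases (q:ℝ) with ⟨g1, _⟩ | ⟨g1, _⟩ <;> rcases abs_cases a with ⟨g2, _⟩ | ⟨g2, _⟩ <;>
        rw [g1, g2]
      · exact ⟨1, by simp, by push_cast; congr 1; ring⟩
      · exact ⟨-1, by simp, by push_cast; congr 1; ring⟩
      · exact ⟨-1, by simp, by push_cast; rw [← abs_neg]; congr 1; ring⟩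
      · exact ⟨1, by simp, by push_cast; rw [← abs_neg]; congr 1; ring⟩
    obtain ⟨σ, hσ, hσ2⟩ := hqa
    have hσ3 : (|(q:ℝ)| - 1) * |(q:ℝ) * ((1:ℤ):ℝ) - a * (σ:ℝ)| ≤ |(q:ℝ)| * (n - 1) + |a| := by
      rw [hσ2, ← rad_iff hq, abs_le, neg_le, rad_iff hq, rad_iff hq]
      constructor <;> nlinarith
    have hvert : ∀ j, 0 ≤ j → j ≤ n - 1 → (f 0 0 ↔ f 0 j) := by
      intro j hj0 hj1
      refine int_const (n-1) (f 0) (fun j hj hj' => ?_) j hj0 hj1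
      have hσ4 : σ = 1 ∨ σ = -1 := by
        rcases abs_cases σ with h | h <;> omega
      rcases hσ4 with rfl | rfl
      · rw [hhor 1 (j+1) (by omega) (by omega) (by omega) hj']
        exact (edge' 1 (j+1) 0 j (by omega) (by omega) (by omega) (by omega) (by omega) (by omega)
          (by omega) (by omega) 1 1 (by simp) hσ3 (by omega) (by omega)).symm
      · rw [hhor 1 j (by omega) (by omega) (by omega) (by omega)]
        exact (edge' 0 (j+1) 1 j (by omega) (by omega) (by omega) (by omega) (by omega) (by omega)
          (by omega) (by omega) (-1) 1 (by simp) hσ3 (by omega) (by omega)).symm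
    intro i j hi0 hi1 hj0 hj1
    exact (hvert j hj0 hj1).trans (hhor i j hi0 hi1 hj0 hj1)

lemma forward {p q m n : ℤ} {a : ℝ} (hp : 4 ≤ |p|) (hq : 3 ≤ |q|)
    (hm1 : |p| + 1 < m) (hm2 : m < 2 * |p| - 1) (hn : |q| ≤ 2 * n - 1)
    (hT : IsPreconnected (Set.range (F p q m n a))) :
    (|(q:ℝ)| * (|(q:ℝ)| - n) ≤ |a| ∧ |a| * (|(q:ℝ)| - 2) ≤ |(q:ℝ)|^2 * (n-1)) ∨
      (|(q:ℝ)| - n ≤ |a| ∧ |a| * (|(q:ℝ)| - 2) ≤ |(q:ℝ)| * (n-1)) := by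
  have hqR : (3:ℝ) ≤ |(q:ℝ)| := by exact_mod_cast hq
  have hnR : |(q:ℝ)| ≤ 2 * n - 1 := by exact_mod_cast hn
  have hn2 : (2:ℝ) ≤ n := by linarith
  have nec : ∀ P : Dg m n → Prop, (∃ e, P e) → (∃ e, ¬ P e) → ∃ e e' : Dg m n, P e ∧ ¬ P e' ∧
      ∃ s t : ℤ, (e.1:ℤ) - (e'.1:ℤ) = s ∧ (e.2:ℤ) - (e'.2:ℤ) = t ∧ |s| ≤ 1 ∧
      (|(q:ℝ)| - 1) * |(q:ℝ) * t - a * s| ≤ |(q:ℝ)| * (n - 1) + |a| := by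
    rintro P ⟨e, he⟩ ⟨e', he'⟩
    obtain ⟨d, d', h1, h2, h3⟩ := disconn hp hq hT P e e' he he'
    have := necessary hp hq hm2 d d' h3 _ _ rfl rfl
    exact ⟨d 0, d' 0, h1, h2, _, _, rfl, rfl, this.1, this.2⟩
  by_contra hcon
  push Not at hcon
  obtain ⟨hc1, hc2⟩ := hcon
  have hm0 : (0:ℤ) ∈ Set.Icc (0:ℤ) (m-1) := ⟨le_rfl, by omega⟩
  have hm1' : (1:ℤ) ∈ Set.Icc (0:ℤ) (m-1) := ⟨by omega, by omega⟩
  have hn0 : (0:ℤ) ∈ Set.Icc (0:ℤ) (n-1) := ⟨le_rfl, by omega⟩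
  have hn1' : (1:ℤ) ∈ Set.Icc (0:ℤ) (n-1) := ⟨by omega, by omega⟩
  have hnn : (n-1:ℤ) ∈ Set.Icc (0:ℤ) (n-1) := ⟨by omega, by omega⟩
  by_cases hA : |(q:ℝ)| * (|(q:ℝ)| - n) ≤ |a|
  · have hA2 := hc1 hA
    obtain ⟨e, e', h1, h2, s, t, hs, ht, hs1, hst⟩ := nec (fun e => (e.1:ℤ) = 0)
      ⟨(⟨0, hm0⟩, ⟨0, hn0⟩), rfl⟩ ⟨(⟨1, hm1'⟩, ⟨0, hn0⟩), by simp⟩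
    have hs0 : |s| = 1 := by
      have : s ≠ 0 := by omega
      have := abs_pos.2 this
      omega
    have ht2 : |t| ≤ n - 1 := ht ▸ (dig_diff e e').2
    have htR : |(t:ℝ)| ≤ n - 1 := by exact_mod_cast ht2
    have hsR : |(s:ℝ)| = 1 := by exact_mod_cast hs0
    have h3 : |a| - |(q:ℝ)| * |(t:ℝ)| ≤ |(q:ℝ) * t - a * s| := by
      have := abs_sub_abs_le_abs_sub (a * s) ((q:ℝ) * t)
      rw [abs_mul, abs_mul, hsR, mul_one, abs_sub_comm] at this
      exact this
    have h4 : |(q:ℝ)| * |(t:ℝ)| ≤ |(q:ℝ)| * (n-1) := by gcongr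
    have h5 : (|(q:ℝ)| - 1) * (|a| - |(q:ℝ)| * (n-1)) ≤ (|(q:ℝ)| - 1) * |(q:ℝ) * t - a * s| :=
      mul_le_mul_of_nonneg_left (by linarith) (by linarith)
    nlinarith
  push Not at hA
  -- no vertical edges
  have novert : ∀ t : ℤ, (|(q:ℝ)| - 1) * |(q:ℝ) * t| ≤ |(q:ℝ)| * (n - 1) + |a| → t = 0 := by
    intro t ht
    by_contra h0
    have h1 : 1 ≤ |t| := Int.one_le_abs h0
    have h1R : (1:ℝ) ≤ |(t:ℝ)| := by exact_mod_cast h1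
    rw [abs_mul] at ht
    have : (|(q:ℝ)| - 1) * (|(q:ℝ)| * 1) ≤ (|(q:ℝ)| - 1) * (|(q:ℝ)| * |(t:ℝ)|) := by
      have : 0 ≤ |(q:ℝ)| - 1 := by linarith
      gcongr
    nlinarith
  by_cases hB : |(q:ℝ)| - n ≤ |a|
  · have hB2 := hc2 hB
    -- all slanted edges go in one direction
    have hdir : ∀ s t : ℤ, |s| ≤ 1 → s ≠ 0 →
        (|(q:ℝ)| - 1) * |(q:ℝ) * t - a * s| ≤ |(q:ℝ)| * (n - 1) + |a| → 0 < ((q:ℝ) * t) * (a * s) := by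
      intro s t hs1 hs0 hst
      by_contra! hneg
      have hs2 : |s| = 1 := by
        have := abs_pos.2 hs0
        omega
      have hsR : |(s:ℝ)| = 1 := by exact_mod_cast hs2
      have h1 : |a| ≤ |(q:ℝ) * t - a * s| := by
        have h2 : |a| = |a * s| := by rw [abs_mul, hsR, mul_one]
        rw [h2]
        apply sq_le_sq.1
        nlinarith [sq_nonneg ((q:ℝ) * t)]
      have h5 : (|(q:ℝ)| - 1) * |a| ≤ (|(q:ℝ)| - 1) * |(q:ℝ) * t - a * s| :=
        mul_le_mul_of_nonneg_left h1 (by linarith)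
      linarith
    by_cases hσ : 0 < (q:ℝ) * a
    · obtain ⟨e, e', h1, h2, s, t, hs, ht, hs1, hst⟩ := nec
        (fun e => (e.1:ℤ) = 0 ∧ (e.2:ℤ) = n - 1)
        ⟨(⟨0, hm0⟩, ⟨n-1, hnn⟩), rfl, rfl⟩ ⟨(⟨1, hm1'⟩, ⟨0, hn0⟩), by simp⟩
      have b1 := e'.1.2.1
      have b2 := e'.2.2.2
      by_cases hs0 : s = 0
      · have := novert t (by simpa [hs0] using hst)
        apply h2
        constructor <;> omega
      · have h3 := hdir s t hs1 hs0 hst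
        rw [abs_le] at hs1
        have hs' : s = -1 := by omega
        have h4 : (q:ℝ) * a * (t * s) = (q:ℝ) * t * (a * s) := by ring
        rw [← h4] at h3
        have h5 : (0:ℝ) < t * s := (mul_pos_iff_of_pos_left hσ).1 h3
        have h6 : 0 < t * s := by exact_mod_cast h5
        rw [hs'] at h6
        omega
    · obtain ⟨e, e', h1, h2, s, t, hs, ht, hs1, hst⟩ := nec
        (fun e => (e.1:ℤ) = 0 ∧ (e.2:ℤ) = 0)
        ⟨(⟨0, hm0⟩, ⟨0, hn0⟩), rfl, rfl⟩ ⟨(⟨1, hm1'⟩, ⟨0, hn0⟩), by simp⟩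
      have b1 := e'.1.2.1
      have b2 := e'.2.2.1
      by_cases hs0 : s = 0
      · have := novert t (by simpa [hs0] using hst)
        apply h2
        constructor <;> omega
      · have h3 := hdir s t hs1 hs0 hst
        rw [abs_le] at hs1
        have hs' : s = -1 := by omega
        have h4 : (q:ℝ) * a * (t * s) = (q:ℝ) * t * (a * s) := by ring
        rw [← h4] at h3
        have h5 : (t:ℝ) * s < 0 := by
          by_contra! h5
          nlinarith
        have h6 : t * s < 0 := by exact_mod_cast h5
        rw [hs'] at h6
        omega
  · push Not at hB
    obtain ⟨e, e', h1, h2, s, t, hs, ht, hs1, hst⟩ := nec (fun e => (e.2:ℤ) = 0)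
      ⟨(⟨0, hm0⟩, ⟨0, hn0⟩), rfl⟩ ⟨(⟨0, hm0⟩, ⟨1, hn1'⟩), by simp⟩
    have ht0 : t ≠ 0 := by omega
    have h1R : (1:ℝ) ≤ |(t:ℝ)| := by exact_mod_cast Int.one_le_abs ht0
    have hsR : |(s:ℝ)| ≤ 1 := by exact_mod_cast hs1
    have h3 : |(q:ℝ)| - |a| ≤ |(q:ℝ) * t - a * s| := by
      have := abs_sub_abs_le_abs_sub ((q:ℝ) * t) (a * s)
      rw [abs_mul, abs_mul] at this
      nlinarith [abs_nonneg a]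
    have h5 : (|(q:ℝ)| - 1) * (|(q:ℝ)| - |a|) ≤ (|(q:ℝ)| - 1) * |(q:ℝ) * t - a * s| :=
      mul_le_mul_of_nonneg_left h3 (by linarith)
    nlinarith

end SA
theorem stmt_1 (p q m n : ℤ) (a : ℝ) (hp : 2 ≤ |p|) (hq : 3 ≤ |q|)
    (hm1 : |p| + 1 < m) (hm2 : m < 2 * |p| - 1) (hn : |q| ≤ 2 * n - 1) :
    IsConnected (selfAffineSet (matA p q a) (digitSet m n)) ↔
      (((|q| : ℝ) * ((|q| : ℝ) - (n : ℝ)) ≤ |a| ∧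
          |a| ≤ (q : ℝ) ^ 2 * ((n : ℝ) - 1) / ((|q| : ℝ) - 2)) ∨
        ((|q| : ℝ) - (n : ℝ) ≤ |a| ∧
          |a| ≤ (|q| : ℝ) * ((n : ℝ) - 1) / ((|q| : ℝ) - 2))) := by
  have hp4 : 4 ≤ |p| := by omega
  have hqR : (3:ℝ) ≤ |(q:ℝ)| := by exact_mod_cast hq
  have hpos : 0 < |(q:ℝ)| - 2 := by linarith
  rw [SA.F_range a hp4 hq, ← sq_abs (q:ℝ), le_div_iff₀ hpos, le_div_iff₀ hpos]
  constructor
  · intro h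
    exact SA.forward hp4 hq hm1 hm2 hn h.isPreconnected
  · intro h
    refine ⟨⟨_, ⟨fun _ => (⟨0, le_rfl, by omega⟩, ⟨0, le_rfl, by omega⟩), rfl⟩⟩, ?_⟩
    exact SA.backward hp4 hq hm1 hn h
end

section
/- Let p, q be integers with |p| ≥ 2 and |q| ≥ 3, let a be a real number, let m be an integer with |p| + 1 < m < 2|p| - 1, and set n = |q|. Then the self-affine set T(A, D) is connected if and only if |a| ≤ q²(|q|−1)/(|q|−2). -/
open Matrix

namespace SelfAff

/-- The inverse of `matA`. -/
noncomputable def B (p q : ℤ) (a : ℝ) : Matrix (Fin 2) (Fin 2) ℝ :=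
  !![(p : ℝ)⁻¹, 0; a * (p : ℝ)⁻¹ * (q : ℝ)⁻¹, (q : ℝ)⁻¹]

lemma matA_inv (p q : ℤ) (a : ℝ) (hp : (p : ℝ) ≠ 0) (hq : (q : ℝ) ≠ 0) :
    (matA p q a)⁻¹ = B p q a := by
  apply Matrix.inv_eq_right_inv
  ext i j
  fin_cases i <;> fin_cases j <;> simp [matA, B, Matrix.mul_apply, Fin.sum_univ_two, hp, hq]
  field_simp
  ring

lemma B_zero (p q : ℤ) (a : ℝ) (v : Fin 2 → ℝ) : (B p q a *ᵥ v) 0 = (p : ℝ)⁻¹ * v 0 := by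
  simp [B, Matrix.mulVec, dotProduct, Fin.sum_univ_two]

lemma B_one (p q : ℤ) (a : ℝ) (v : Fin 2 → ℝ) :
    (B p q a *ᵥ v) 1 = a * (p : ℝ)⁻¹ * (q : ℝ)⁻¹ * v 0 + (q : ℝ)⁻¹ * v 1 := by
  simp [B, Matrix.mulVec, dotProduct, Fin.sum_univ_two]

lemma abs_inv_le {p : ℤ} {c : ℝ} (hc : 0 < c) (hp : c ≤ |(p : ℝ)|) : |(p : ℝ)⁻¹| ≤ c⁻¹ := by
  rw [abs_inv]; exact inv_anti₀ hc hp

lemma B_pow_bound (p q : ℤ) (a : ℝ) (hp : (2 : ℝ) ≤ |(p : ℝ)|) (hq : (3 : ℝ) ≤ |(q : ℝ)|)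
    (v : Fin 2 → ℝ) (k : ℕ) :
    |((B p q a ^ k) *ᵥ v) 0| ≤ (1 / 2) ^ k * |v 0| ∧
    |((B p q a ^ k) *ᵥ v) 1| ≤ (1 / 2) ^ k * (|v 1| + |a| * |v 0|) := by
  have h1 := abs_inv_le (by norm_num) hp
  have h2 := abs_inv_le (by norm_num) hq
  induction k with
  | zero => simp; positivity
  | succ k ih =>
    obtain ⟨i0, i1⟩ := ih
    rw [pow_succ' (B p q a), ← Matrix.mulVec_mulVec, B_zero, B_one]
    set w := (B p q a ^ k) *ᵥ v
    have e0 : |(p : ℝ)⁻¹ * w 0| ≤ 2⁻¹ * ((1 / 2) ^ k * |v 0|) := by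
      rw [abs_mul]; gcongr
    constructor
    · calc _ ≤ _ := e0
        _ = _ := by ring
    · have e1 : |(q : ℝ)⁻¹ * w 1| ≤ 3⁻¹ * ((1 / 2) ^ k * (|v 1| + |a| * |v 0|)) := by
        rw [abs_mul]; gcongr
      have e2 : |a * (p : ℝ)⁻¹ * (q : ℝ)⁻¹ * w 0| ≤ |a| * 2⁻¹ * 3⁻¹ * ((1 / 2) ^ k * |v 0|) := by
        rw [abs_mul, abs_mul, abs_mul]; gcongr
      have e3 := abs_add_le (a * (p : ℝ)⁻¹ * (q : ℝ)⁻¹ * w 0) ((q : ℝ)⁻¹ * w 1)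
      have e4 : 0 ≤ (1 / 2 : ℝ) ^ k * |v 1| := by positivity
      rw [pow_succ]
      nlinarith

lemma B_pow_norm (p q : ℤ) (a : ℝ) (hp : (2 : ℝ) ≤ |(p : ℝ)|) (hq : (3 : ℝ) ≤ |(q : ℝ)|)
    (v : Fin 2 → ℝ) (k : ℕ) :
    ‖(B p q a ^ k) *ᵥ v‖ ≤ (1 / 2) ^ k * ((1 + |a|) * ‖v‖) := by
  obtain ⟨h0, h1⟩ := B_pow_bound p q a hp hq v k
  have n0 : |v 0| ≤ ‖v‖ := norm_le_pi_norm v 0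
  have n1 : |v 1| ≤ ‖v‖ := norm_le_pi_norm v 1
  rw [pi_norm_le_iff_of_nonneg (by positivity)]
  intro i
  fin_cases i
  · refine h0.trans ?_
    gcongr
    nlinarith [abs_nonneg a, abs_nonneg (v 0)]
  · refine h1.trans ?_
    gcongr
    nlinarith [abs_nonneg a, abs_nonneg (v 0)]

/-- The self-affine set in terms of `B`. -/
def T (p q m : ℤ) (a : ℝ) : Set (Fin 2 → ℝ) :=
  {x | ∃ d : ℕ → (Fin 2 → ℝ), (∀ k, d k ∈ digitSet m |q|) ∧
    HasSum (fun k => (B p q a ^ (k + 1)) *ᵥ (d k)) x}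

lemma digit_norm {m n : ℤ} {d : Fin 2 → ℝ} (hd : d ∈ digitSet m n) :
    ‖d‖ ≤ |(m : ℝ)| + |(n : ℝ)| := by
  obtain ⟨i, j, h1, h2, h3, h4, rfl⟩ := hd
  have a1 : (0 : ℝ) ≤ i := by exact_mod_cast h1
  have a2 : (i : ℝ) ≤ m - 1 := by exact_mod_cast h2
  have a3 : (0 : ℝ) ≤ j := by exact_mod_cast h3
  have a4 : (j : ℝ) ≤ n - 1 := by exact_mod_cast h4
  rw [pi_norm_le_iff_of_nonneg (by positivity)]
  have b1 := le_abs_self (m : ℝ)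
  have b2 := le_abs_self (n : ℝ)
  intro t
  fin_cases t
  · simp [abs_of_nonneg a1]; linarith [abs_nonneg (n : ℝ)]
  · simp [abs_of_nonneg a3]; linarith [abs_nonneg (m : ℝ)]

lemma digit_finite (m n : ℤ) : (digitSet m n).Finite := by
  apply ((Set.finite_Icc (0 : ℤ) (m - 1)).prod (Set.finite_Icc (0 : ℤ) (n - 1))
    |>.image (fun t : ℤ × ℤ => (![(t.1 : ℝ), (t.2 : ℝ)] : Fin 2 → ℝ))).subset
  rintro _ ⟨i, j, h1, h2, h3, h4, rfl⟩
  exact ⟨(i, j), ⟨⟨h1, h2⟩, ⟨h3, h4⟩⟩, rfl⟩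

lemma digit_shift_bound (p q m : ℤ) (a : ℝ) (hp : (2 : ℝ) ≤ |(p : ℝ)|) (hq : (3 : ℝ) ≤ |(q : ℝ)|)
    {d : Fin 2 → ℝ} {n : ℤ} (hd : d ∈ digitSet m n) (k : ℕ) :
    ‖(B p q a ^ (k + 1)) *ᵥ d‖ ≤ (1 / 2) ^ k * ((1 + |a|) * (|(m : ℝ)| + |(n : ℝ)|)) := by
  refine (B_pow_norm p q a hp hq d (k + 1)).trans ?_
  have := digit_norm hd
  have h : ((1 : ℝ) / 2) ^ (k + 1) ≤ (1 / 2) ^ k := by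
    rw [pow_succ]; nlinarith [show (0 : ℝ) ≤ (1 / 2) ^ k by positivity]
  gcongr

lemma summable_bd (C : ℝ) : Summable (fun k : ℕ => (1 / 2 : ℝ) ^ k * C) :=
  summable_geometric_two.mul_right C

lemma T_eq_image (p q m : ℤ) (a : ℝ) (hp : (2 : ℝ) ≤ |(p : ℝ)|) (hq : (3 : ℝ) ≤ |(q : ℝ)|) :
    T p q m a = (fun d : ℕ → (Fin 2 → ℝ) => ∑' k, (B p q a ^ (k + 1)) *ᵥ (d k)) ''
      (Set.univ.pi fun _ => digitSet m |q|) := by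
  ext x
  constructor
  · rintro ⟨d, hd, hs⟩
    exact ⟨d, fun k _ => hd k, hs.tsum_eq⟩
  · rintro ⟨d, hd, rfl⟩
    refine ⟨d, fun k => hd k trivial, Summable.hasSum ?_⟩
    exact Summable.of_norm_bounded (summable_bd _)
      (fun k => digit_shift_bound p q m a hp hq (hd k trivial) k)

lemma T_compact (p q m : ℤ) (a : ℝ) (hp : (2 : ℝ) ≤ |(p : ℝ)|) (hq : (3 : ℝ) ≤ |(q : ℝ)|) :
    IsCompact (T p q m a) := by
  rw [T_eq_image p q m a hp hq]
  apply IsCompact.image_of_continuousOn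
  · exact isCompact_univ_pi fun _ => (digit_finite m |q|).isCompact
  · apply continuousOn_tsum (u := fun k => (1 / 2 : ℝ) ^ k * ((1 + |a|) * (|(m : ℝ)| + |((|q| : ℤ) : ℝ)|)))
    · intro k
      apply Continuous.continuousOn
      exact Continuous.matrix_mulVec continuous_const (continuous_apply k)
    · exact summable_bd _
    · intro k d hd
      exact digit_shift_bound p q m a hp hq (hd k trivial) k

lemma digit_zero {m n : ℤ} (hm : 1 ≤ m) (hn : 1 ≤ n) : (0 : Fin 2 → ℝ) ∈ digitSet m n :=
  ⟨0, 0, le_rfl, by omega, le_rfl, by omega, by ext i; fin_cases i <;> simp⟩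

lemma T_zero (p q m : ℤ) (a : ℝ) (hm : 1 ≤ m) (hq : 1 ≤ |q|) : (0 : Fin 2 → ℝ) ∈ T p q m a :=
  ⟨fun _ => 0, fun _ => digit_zero hm hq, by simp⟩

lemma hasSum_B {p q : ℤ} {a : ℝ} {u : ℕ → (Fin 2 → ℝ)} {x : Fin 2 → ℝ} (h : HasSum u x) :
    HasSum (fun k => B p q a *ᵥ u k) (B p q a *ᵥ x) := by
  have := h.mapL (LinearMap.toContinuousLinearMap (Matrix.mulVecLin (B p q a)))
  simpa using this

/-- Pieces are inside `T`. -/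
lemma T_mem_of (p q m : ℤ) (a : ℝ) {z d : Fin 2 → ℝ} (hz : z ∈ T p q m a)
    (hd : d ∈ digitSet m |q|) : B p q a *ᵥ (z + d) ∈ T p q m a := by
  obtain ⟨e, he, hs⟩ := hz
  refine ⟨fun k => Nat.casesOn k d e, ?_, ?_⟩
  · intro k; cases k
    · exact hd
    · exact he _
  · rw [← hasSum_nat_add_iff' 1]
    have := hasSum_B (p := p) (q := q) (a := a) hs
    simp only [Matrix.mulVec_mulVec, ← pow_succ'] at this
    simpa [Matrix.mulVec_add] using this

lemma T_exists (p q m : ℤ) (a : ℝ) (hp : (2 : ℝ) ≤ |(p : ℝ)|) (hq : (3 : ℝ) ≤ |(q : ℝ)|)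
    {x : Fin 2 → ℝ} (hx : x ∈ T p q m a) :
    ∃ z ∈ T p q m a, ∃ d ∈ digitSet m |q|, x = B p q a *ᵥ (z + d) := by
  obtain ⟨e, he, hs⟩ := hx
  have hS : Summable (fun k => (B p q a ^ (k + 1)) *ᵥ (e (k + 1))) :=
    Summable.of_norm_bounded (summable_bd _)
      (fun k => digit_shift_bound p q m a hp hq (he (k + 1)) k)
  refine ⟨_, ⟨fun k => e (k + 1), fun k => he _, hS.hasSum⟩, e 0, he 0, ?_⟩
  have h1 := hasSum_B (p := p) (q := q) (a := a) hS.hasSum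
  simp only [Matrix.mulVec_mulVec, ← pow_succ'] at h1
  rw [← hasSum_nat_add_iff' 1] at hs
  have := hs.unique h1
  simp only [Finset.range_one, Finset.sum_singleton, zero_add, pow_one] at this
  rw [Matrix.mulVec_add, ← this]
  abel

/-- Coordinates of the piece map. -/
lemma piece_coord (p q : ℤ) (a : ℝ) (hp : (p : ℝ) ≠ 0) (hq : (q : ℝ) ≠ 0) (x w : Fin 2 → ℝ) :
    x = B p q a *ᵥ w ↔ ((p : ℝ) * x 0 = w 0 ∧ (q : ℝ) * x 1 - a * x 0 = w 1) := by
  constructor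
  · rintro rfl
    rw [B_zero, B_one]
    constructor <;> field_simp
    ring
  · rintro ⟨h0, h1⟩
    ext i
    fin_cases i
    · simp only [Fin.zero_eta, B_zero, ← h0]; field_simp
    · simp only [Fin.mk_one, B_one, ← h0, ← h1]; field_simp; ring

/-- A bounded set stable under expansion modulo difference digits lies in `T - T`. -/
lemma diff_mem (p q m : ℤ) (a : ℝ) (hp : (2 : ℝ) ≤ |(p : ℝ)|) (hq : (3 : ℝ) ≤ |(q : ℝ)|)
    (E : Set (Fin 2 → ℝ)) (C : ℝ) (hC : ∀ v ∈ E, ‖v‖ ≤ C)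
    (hE : ∀ v ∈ E, ∃ w ∈ E, ∃ d ∈ digitSet m |q|, ∃ d' ∈ digitSet m |q|,
      v = B p q a *ᵥ (w + (d - d')))
    (v : Fin 2 → ℝ) (hv : v ∈ E) : ∃ z ∈ T p q m a, ∃ z' ∈ T p q m a, v = z - z' := by
  choose! w hw d hd d' hd' h using hE
  let V : ℕ → (Fin 2 → ℝ) := fun k => w^[k] v
  have hV : ∀ k, V k ∈ E := by
    intro k
    induction k with
    | zero => exact hv
    | succ k ih => simp only [V, Function.iterate_succ_apply']; exact hw _ ih
  have hS : ∀ k, V k = B p q a *ᵥ (V (k + 1) + (d (V k) - d' (V k))) := by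
    intro k
    simp only [V, Function.iterate_succ_apply']; exact h _ (hV k)
  have s1 : Summable (fun k => (B p q a ^ (k + 1)) *ᵥ (d (V k))) :=
    Summable.of_norm_bounded (summable_bd _)
      (fun k => digit_shift_bound p q m a hp hq (hd _ (hV k)) k)
  have s2 : Summable (fun k => (B p q a ^ (k + 1)) *ᵥ (d' (V k))) :=
    Summable.of_norm_bounded (summable_bd _)
      (fun k => digit_shift_bound p q m a hp hq (hd' _ (hV k)) k)
  refine ⟨_, ⟨_, fun k => hd _ (hV k), s1.hasSum⟩, _, ⟨_, fun k => hd' _ (hV k), s2.hasSum⟩, ?_⟩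
  have h3 := (s1.hasSum.sub s2.hasSum).tendsto_sum_nat
  have h4 : ∀ N, ∑ k ∈ Finset.range N, ((B p q a ^ (k + 1)) *ᵥ (d (V k)) -
      (B p q a ^ (k + 1)) *ᵥ (d' (V k))) = v - (B p q a ^ N) *ᵥ V N := by
    intro N
    induction N with
    | zero => simp [V]
    | succ N ih =>
      rw [Finset.sum_range_succ, ih]
      nth_rw 1 [hS N]
      rw [Matrix.mulVec_mulVec, ← pow_succ, Matrix.mulVec_add, Matrix.mulVec_sub]
      abel
  have h5 : Filter.Tendsto (fun N => (B p q a ^ N) *ᵥ V N) Filter.atTop (nhds 0) := by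
    apply squeeze_zero_norm (a := fun N : ℕ => (1 / 2 : ℝ) ^ N * ((1 + |a|) * C))
    · intro N
      refine (B_pow_norm p q a hp hq _ N).trans ?_
      have := hC _ (hV N)
      gcongr
    · have := (tendsto_pow_atTop_nhds_zero_of_lt_one (r := (1 / 2 : ℝ)) (by norm_num)
        (by norm_num)).mul_const ((1 + |a|) * C)
      simpa using this
  simp only [h4] at h3
  have h6 := (tendsto_const_nhds (x := v)).sub h5
  rw [sub_zero] at h6
  exact tendsto_nhds_unique h6 h3

/-- Two points in the same piece of level `N`. -/
def S (p q m : ℤ) (a : ℝ) : ℕ → (Fin 2 → ℝ) → (Fin 2 → ℝ) → Prop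
  | 0 => fun x y => x ∈ T p q m a ∧ y ∈ T p q m a
  | N + 1 => fun x y => ∃ d ∈ digitSet m |q|, ∃ x' y', S p q m a N x' y' ∧
      x = B p q a *ᵥ (x' + d) ∧ y = B p q a *ᵥ (y' + d)

lemma S_symm (p q m : ℤ) (a : ℝ) (N : ℕ) {x y : Fin 2 → ℝ} (h : S p q m a N x y) :
    S p q m a N y x := by
  induction N generalizing x y with
  | zero => exact ⟨h.2, h.1⟩
  | succ N ih =>
    obtain ⟨d, hd, x', y', h, hx, hy⟩ := h
    exact ⟨d, hd, y', x', ih h, hy, hx⟩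

lemma S_spec (p q m : ℤ) (a : ℝ) (N : ℕ) {x y : Fin 2 → ℝ} (h : S p q m a N x y) :
    x ∈ T p q m a ∧ y ∈ T p q m a ∧
    ∃ x' ∈ T p q m a, ∃ y' ∈ T p q m a, x - y = (B p q a ^ N) *ᵥ (x' - y') := by
  induction N generalizing x y with
  | zero => exact ⟨h.1, h.2, x, h.1, y, h.2, by simp⟩
  | succ N ih =>
    obtain ⟨d, hd, x', y', h, rfl, rfl⟩ := h
    obtain ⟨h1, h2, u, hu, v, hv, e⟩ := ih h
    refine ⟨T_mem_of p q m a h1 hd, T_mem_of p q m a h2 hd, u, hu, v, hv, ?_⟩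
    rw [pow_succ', ← Matrix.mulVec_mulVec, ← e, ← Matrix.mulVec_sub]
    congr 1
    abel

lemma chain_connected (p q m : ℤ) (a : ℝ) (hp : (2 : ℝ) ≤ |(p : ℝ)|) (hq : (3 : ℝ) ≤ |(q : ℝ)|)
    (h : ∀ N, ∀ x ∈ T p q m a, ∀ y ∈ T p q m a, Relation.ReflTransGen (S p q m a N) x y) :
    IsPreconnected (T p q m a) := by
  have hc := T_compact p q m a hp hq
  obtain ⟨C, hC⟩ := hc.isBounded.exists_norm_le
  rw [isPreconnected_iff_subset_of_fully_disjoint_closed hc.isClosed]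
  intro u v hu hv huv hd
  by_contra hcon
  push Not at hcon
  obtain ⟨h1, h2⟩ := hcon
  obtain ⟨x, hx, hxu⟩ := Set.not_subset.1 h1
  obtain ⟨y, hy, hyv⟩ := Set.not_subset.1 h2
  have hyu : y ∈ u := (huv hy).resolve_right hyv
  have hd' : Disjoint (T p q m a ∩ u) v := hd.mono_left Set.inter_subset_right
  obtain ⟨δ, hδ, hth⟩ := hd'.exists_thickenings (hc.inter_right hu) hv
  obtain ⟨N, hN⟩ : ∃ N : ℕ, (1 / 2 : ℝ) ^ N * ((1 + |a|) * (C + C)) < δ := by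
    have := (tendsto_pow_atTop_nhds_zero_of_lt_one (r := (1 / 2 : ℝ)) (by norm_num)
        (by norm_num)).mul_const ((1 + |a|) * (C + C))
    rw [zero_mul] at this
    exact (this.eventually (gt_mem_nhds hδ)).exists
  have key : ∀ z, Relation.ReflTransGen (S p q m a N) y z → z ∈ u := by
    intro z hz
    induction hz with
    | refl => exact hyu
    | @tail b c _ hbc ih =>
      obtain ⟨hb, hc', b', hb', c', hc'', e⟩ := S_spec p q m a N hbc
      by_contra hcu
      have hcv := (huv hc').resolve_left hcu
      have hdist : dist c b < δ := by
        rw [dist_comm, dist_eq_norm, e]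
        refine (B_pow_norm p q a hp hq _ N).trans_lt (lt_of_le_of_lt ?_ hN)
        have := (norm_sub_le b' c').trans (add_le_add (hC _ hb') (hC _ hc''))
        gcongr
      have hdl := Set.disjoint_left.1 hth
      refine @hdl c ?_ ?_
      · exact Metric.mem_thickening_iff.2 ⟨b, ⟨hb, ih⟩, hdist⟩
      · exact Metric.self_subset_thickening hδ _ hcv
  exact hxu (key x (h N y hy x hx))

lemma chains (p q m : ℤ) (a : ℝ) (hp : (2 : ℝ) ≤ |(p : ℝ)|) (hq : (3 : ℝ) ≤ |(q : ℝ)|)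
    (hm : 1 ≤ m)
    (hv : ∃ z ∈ T p q m a, ∃ z' ∈ T p q m a, (![0, 1] : Fin 2 → ℝ) = z - z')
    (hh : ∃ j : ℤ, |j| ≤ |q| - 1 ∧
      ∃ z ∈ T p q m a, ∃ z' ∈ T p q m a, (![1, (j : ℝ)] : Fin 2 → ℝ) = z - z') :
    ∀ N, ∀ x ∈ T p q m a, ∀ y ∈ T p q m a, Relation.ReflTransGen (S p q m a N) x y := by
  have hq1 : 1 ≤ |q| := by
    have : (3 : ℝ) ≤ ((|q| : ℤ) : ℝ) := by rw [Int.cast_abs]; exact hq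
    have : (3 : ℤ) ≤ |q| := by exact_mod_cast this
    omega
  have hT0 := T_zero p q m a hm hq1
  intro N
  induction N with
  | zero => exact fun x hx y hy => Relation.ReflTransGen.single ⟨hx, hy⟩
  | succ N ih =>
    set R := Relation.ReflTransGen (S p q m a (N + 1)) with hR
    have Rsymm : ∀ {x y}, R x y → R y x := by
      intro x y h
      induction h with
      | refl => exact Relation.ReflTransGen.refl
      | tail _ hbc ih => exact Relation.ReflTransGen.head (S_symm p q m a _ hbc) ih
    let P : (Fin 2 → ℝ) → (Fin 2 → ℝ) → Prop := fun d d' =>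
      ∀ x ∈ T p q m a, ∀ y ∈ T p q m a, R (B p q a *ᵥ (x + d)) (B p q a *ᵥ (y + d'))
    have Prefl : ∀ d ∈ digitSet m |q|, P d d := by
      intro d hd x hx y hy
      have := ih x hx y hy
      clear hx hy
      induction this with
      | refl => exact Relation.ReflTransGen.refl
      | tail _ hbc ih' => exact Relation.ReflTransGen.tail ih' ⟨d, hd, _, _, hbc, rfl, rfl⟩
    have Psymm : ∀ d d', P d d' → P d' d := fun d d' h x hx y hy => Rsymm (h y hy x hx)
    have Ptrans : ∀ d d' d'', P d d' → P d' d'' → P d d'' :=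
      fun d d' d'' h1 h2 x hx y hy => (h1 x hx 0 hT0).trans (h2 0 hT0 y hy)
    have Pstep : ∀ d ∈ digitSet m |q|, ∀ d' ∈ digitSet m |q|,
        (∃ z ∈ T p q m a, ∃ z' ∈ T p q m a, d' - d = z - z') → P d d' := by
      rintro d hd d' hd' ⟨z, hz, z', hz', e⟩ x hx y hy
      have e' : z' + d' = z + d := by
        have : d' = (z - z') + d := by rw [← e]; abel
        rw [this]; abel
      have a1 := Prefl d hd x hx z hz
      have a2 := Prefl d' hd' z' hz' y hy
      rw [e'] at a2
      exact a1.trans a2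
    have hmem : ∀ i j : ℤ, 0 ≤ i → i ≤ m - 1 → 0 ≤ j → j ≤ |q| - 1 →
        (![(i : ℝ), (j : ℝ)] : Fin 2 → ℝ) ∈ digitSet m |q| :=
      fun i j h1 h2 h3 h4 => ⟨i, j, h1, h2, h3, h4, rfl⟩
    have col : ∀ i : ℤ, 0 ≤ i → i ≤ m - 1 → ∀ j : ℕ, (j : ℤ) ≤ |q| - 1 →
        P ![(i : ℝ), ((0 : ℤ) : ℝ)] ![(i : ℝ), ((j : ℤ) : ℝ)] := by
      intro i h1 h2 j
      induction j with
      | zero => intro _; exact Prefl _ (hmem i 0 h1 h2 le_rfl (by omega))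
      | succ j ihj =>
        intro hj
        push_cast at hj
        refine Ptrans _ _ _ (ihj (by omega)) (Pstep _ (hmem i j h1 h2 (by omega) (by omega)) _
          (hmem i _ h1 h2 (by omega) (by push_cast; omega)) ?_)
        obtain ⟨z, hz, z', hz', e⟩ := hv
        refine ⟨z, hz, z', hz', ?_⟩
        rw [← e]
        ext t; fin_cases t <;> simp
    have col' : ∀ i j : ℤ, 0 ≤ i → i ≤ m - 1 → 0 ≤ j → j ≤ |q| - 1 →
        P ![(i : ℝ), ((0 : ℤ) : ℝ)] ![(i : ℝ), (j : ℝ)] := by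
      intro i j h1 h2 h3 h4
      lift j to ℕ using h3
      exact col i h1 h2 j h4
    have row : ∀ i : ℕ, (i : ℤ) ≤ m - 1 →
        P ![((0 : ℤ) : ℝ), ((0 : ℤ) : ℝ)] ![((i : ℤ) : ℝ), ((0 : ℤ) : ℝ)] := by
      intro i
      induction i with
      | zero => intro h; exact Prefl _ (hmem 0 0 le_rfl (by omega) le_rfl (by omega))
      | succ i ihi =>
        intro hi
        push_cast at hi
        refine Ptrans _ _ _ (ihi (by omega)) ?_
        obtain ⟨j, hj, z, hz, z', hz', e⟩ := hh
        rw [abs_le] at hj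
        have hb : 0 ≤ max 0 (-j) ∧ max 0 (-j) ≤ |q| - 1 ∧ 0 ≤ max 0 (-j) + j ∧
            max 0 (-j) + j ≤ |q| - 1 := by omega
        obtain ⟨b1, b2, b3, b4⟩ := hb
        refine Ptrans _ _ _ (col' i (max 0 (-j)) (by omega) (by omega) b1 b2) ?_
        refine Ptrans _ _ _ ?_ (Psymm _ _ (col' ((i + 1 : ℕ) : ℤ) (max 0 (-j) + j) (by omega)
          (by push_cast; omega) b3 b4))
        refine Pstep _ (hmem _ _ (by omega) (by omega) b1 b2) _
          (hmem _ _ (by omega) (by push_cast; omega) b3 b4) ⟨z, hz, z', hz', ?_⟩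
        rw [← e]
        ext t; fin_cases t <;> simp
    intro x hx y hy
    obtain ⟨x', hx', d, ⟨i, j, h1, h2, h3, h4, rfl⟩, rfl⟩ := T_exists p q m a hp hq hx
    obtain ⟨y', hy', d, ⟨i', j', h1', h2', h3', h4', rfl⟩, rfl⟩ := T_exists p q m a hp hq hy
    have g1 := col' i j h1 h2 h3 h4
    have g2 := col' i' j' h1' h2' h3' h4'
    lift i to ℕ using h1
    lift i' to ℕ using h1'
    exact Ptrans _ _ _ (Psymm _ _ (Ptrans _ _ _ (row i h2) g1)) (Ptrans _ _ _ (row i' h2') g2)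
      x' hx' y' hy'



lemma sup_bound {α : Type*} (X : Set α) (f : α → ℝ) (c r C : ℝ) (hr : 1 < r)
    (hC : ∀ x ∈ X, f x ≤ C) (h : ∀ x ∈ X, ∃ y ∈ X, r * f x ≤ c + f y) :
    ∀ x ∈ X, f x ≤ c / (r - 1) := by
  intro x hx
  have hne : (f '' X).Nonempty := ⟨f x, x, hx, rfl⟩
  have hbd : BddAbove (f '' X) := ⟨C, by rintro _ ⟨y, hy, rfl⟩; exact hC y hy⟩
  set M := sSup (f '' X)
  have hM : ∀ y ∈ X, f y ≤ M := fun y hy => le_csSup hbd ⟨y, hy, rfl⟩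
  have h2 : M ≤ (c + M) / r := by
    apply csSup_le hne
    rintro _ ⟨y, hy, rfl⟩
    obtain ⟨z, hz, h3⟩ := h y hy
    rw [le_div_iff₀ (by linarith)]
    linarith [hM z hz]
  rw [le_div_iff₀ (by linarith)] at h2
  refine (hM x hx).trans ?_
  rw [le_div_iff₀ (by linarith)]
  linarith

lemma digit_diff {x y n : ℤ} (h1 : 0 ≤ x) (h2 : x ≤ n - 1) (h3 : 0 ≤ y) (h4 : y ≤ n - 1) :
    |(x : ℝ) - y| ≤ n - 1 := by
  have : |x - y| ≤ n - 1 := by rw [abs_le]; constructor <;> omega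
  exact_mod_cast this

lemma dx_bound (p q m : ℤ) (a : ℝ) (hp : (2 : ℝ) ≤ |(p : ℝ)|) (hq : (3 : ℝ) ≤ |(q : ℝ)|)
    (hm2 : (m : ℝ) < 2 * |(p : ℝ)| - 1) {z z' : Fin 2 → ℝ} (hz : z ∈ T p q m a)
    (hz' : z' ∈ T p q m a) : |z 0 - z' 0| < 2 := by
  obtain ⟨C, hC⟩ := (T_compact p q m a hp hq).isBounded.exists_norm_le
  have hp0 : (p : ℝ) ≠ 0 := by intro h; rw [h] at hp; norm_num at hp
  have hq0 : (q : ℝ) ≠ 0 := by intro h; rw [h] at hq; norm_num at hq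
  have := sup_bound (T p q m a ×ˢ T p q m a) (fun w => |w.1 0 - w.2 0|) (m - 1) |(p : ℝ)| (C + C)
    (by linarith) ?_ ?_ (z, z') ⟨hz, hz'⟩
  · refine this.trans_lt ?_
    rw [div_lt_iff₀ (by linarith)]; linarith
  · rintro ⟨x, y⟩ ⟨hx, hy⟩
    have h1 := norm_le_pi_norm x 0
    have h2 := norm_le_pi_norm y 0
    rw [Real.norm_eq_abs] at h1 h2
    exact (abs_sub _ _).trans (add_le_add (h1.trans (hC _ hx)) (h2.trans (hC _ hy)))
  · rintro ⟨x, y⟩ ⟨hx, hy⟩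
    obtain ⟨x', hx', _, ⟨i, j, h1, h2, h3, h4, rfl⟩, ex⟩ := T_exists p q m a hp hq hx
    obtain ⟨y', hy', _, ⟨i', j', h1', h2', h3', h4', rfl⟩, ey⟩ := T_exists p q m a hp hq hy
    refine ⟨(x', y'), ⟨hx', hy'⟩, ?_⟩
    obtain ⟨a1, -⟩ := (piece_coord p q a hp0 hq0 _ _).1 ex
    obtain ⟨b1, -⟩ := (piece_coord p q a hp0 hq0 _ _).1 ey
    simp at a1 b1
    have hi := digit_diff h1 h2 h1' h2'
    dsimp only
    rw [← abs_mul, show (p : ℝ) * (x 0 - y 0) = ((i : ℝ) - i') + (x' 0 - y' 0) by linarith]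
    exact (abs_add_le _ _).trans (by linarith)

lemma int_abs_le_one {e : ℤ} {x : ℝ} (h : x = e) (hx : |x| < 2) : |x| ≤ 1 := by
  rw [h] at hx ⊢
  have : |e| < 2 := by exact_mod_cast hx
  have : |e| ≤ 1 := by omega
  exact_mod_cast this

lemma dy_bound (p q m : ℤ) (a : ℝ) (hp : (2 : ℝ) ≤ |(p : ℝ)|) (hq : (3 : ℝ) ≤ |(q : ℝ)|)
    (hm2 : (m : ℝ) < 2 * |(p : ℝ)| - 1) {z z' : Fin 2 → ℝ} (hz : z ∈ T p q m a)
    (hz' : z' ∈ T p q m a) (hint : ∃ e : ℤ, z 0 - z' 0 = e) :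
    |z 1 - z' 1| ≤ (|a| + (|(q : ℝ)| - 1)) / (|(q : ℝ)| - 1) := by
  obtain ⟨C, hC⟩ := (T_compact p q m a hp hq).isBounded.exists_norm_le
  have hp0 : (p : ℝ) ≠ 0 := by intro h; rw [h] at hp; norm_num at hp
  have hq0 : (q : ℝ) ≠ 0 := by intro h; rw [h] at hq; norm_num at hq
  refine sup_bound {w : (Fin 2 → ℝ) × (Fin 2 → ℝ) | w.1 ∈ T p q m a ∧ w.2 ∈ T p q m a ∧
    ∃ e : ℤ, w.1 0 - w.2 0 = e} (fun w => |w.1 1 - w.2 1|) (|a| + (|(q : ℝ)| - 1)) |(q : ℝ)| (C + C)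
    (by linarith) ?_ ?_ (z, z') ⟨hz, hz', hint⟩
  · rintro ⟨x, y⟩ ⟨hx, hy, -⟩
    have h1 := norm_le_pi_norm x 1
    have h2 := norm_le_pi_norm y 1
    rw [Real.norm_eq_abs] at h1 h2
    exact (abs_sub _ _).trans (add_le_add (h1.trans (hC _ hx)) (h2.trans (hC _ hy)))
  · rintro ⟨x, y⟩ ⟨hx, hy, e, he⟩
    dsimp only at hx hy he
    have hdx := int_abs_le_one he (dx_bound p q m a hp hq hm2 hx hy)
    obtain ⟨x', hx', _, ⟨i, j, h1, h2, h3, h4, rfl⟩, ex⟩ := T_exists p q m a hp hq hx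
    obtain ⟨y', hy', _, ⟨i', j', h1', h2', h3', h4', rfl⟩, ey⟩ := T_exists p q m a hp hq hy
    obtain ⟨a1, a2⟩ := (piece_coord p q a hp0 hq0 _ _).1 ex
    obtain ⟨b1, b2⟩ := (piece_coord p q a hp0 hq0 _ _).1 ey
    simp at a1 b1 a2 b2
    refine ⟨(x', y'), ⟨hx', hy', p * e - (i - i'), ?_⟩, ?_⟩
    · push_cast
      rw [← he]
      linarith
    have hj := digit_diff h3 h4 h3' h4'
    rw [Int.cast_abs] at hj
    dsimp only
    rw [← abs_mul, show (q : ℝ) * (x 1 - y 1) = a * (x 0 - y 0) + ((j : ℝ) - j') + (x' 1 - y' 1) by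
      linarith]
    have hm : |a * (x 0 - y 0)| ≤ |a| := by
      rw [abs_mul]; nlinarith [abs_nonneg a]
    refine (abs_add_le _ _).trans (add_le_add ((abs_add_le _ _).trans (by linarith)) le_rfl)

lemma necessary (p q m : ℤ) (a : ℝ) (hp : (2 : ℝ) ≤ |(p : ℝ)|) (hq : (3 : ℝ) ≤ |(q : ℝ)|)
    (hm : 2 ≤ m) (hm2 : (m : ℝ) < 2 * |(p : ℝ)| - 1) (hc : IsPreconnected (T p q m a)) :
    |a| ≤ (q : ℝ) ^ 2 * (|(q : ℝ)| - 1) / (|(q : ℝ)| - 2) := by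
  have hp0 : (p : ℝ) ≠ 0 := by intro h; rw [h] at hp; norm_num at hp
  have hq0 : (q : ℝ) ≠ 0 := by intro h; rw [h] at hq; norm_num at hq
  have hq1 : 1 ≤ |q| := by
    have : (3 : ℝ) ≤ ((|q| : ℤ) : ℝ) := by rw [Int.cast_abs]; exact hq
    have : (3 : ℤ) ≤ |q| := by exact_mod_cast this
    omega
  have hT0 := T_zero p q m a (by omega : 1 ≤ m) hq1
  let W : Set (Fin 2 → ℝ) → Set (Fin 2 → ℝ) := fun K =>
    (fun w : (Fin 2 → ℝ) × (Fin 2 → ℝ) => B p q a *ᵥ (w.1 + w.2)) '' (T p q m a ×ˢ K)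
  have hW : ∀ K ⊆ digitSet m |q|, IsClosed (W K) := by
    intro K hK
    apply IsCompact.isClosed
    apply ((T_compact p q m a hp hq).prod ((digit_finite m |q|).subset hK).isCompact).image
    exact Continuous.matrix_mulVec continuous_const (continuous_fst.add continuous_snd)
  have hK1 : {d ∈ digitSet m |q| | d 0 = 0} ⊆ digitSet m |q| := Set.sep_subset _ _
  have hK2 : {d ∈ digitSet m |q| | d 0 ≠ 0} ⊆ digitSet m |q| := Set.sep_subset _ _
  have := isPreconnected_closed_iff.1 hc _ _ (hW _ hK1) (hW _ hK2) ?_ ?_ ?_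
  · obtain ⟨x, hx, ⟨⟨z, d⟩, ⟨hz, hd, hd0⟩, e⟩, ⟨⟨z', d'⟩, ⟨hz', hd', hd0'⟩, e'⟩⟩ := this
    dsimp only at hz hd hd0 e hz' hd' hd0' e'
    obtain ⟨i, j, h1, h2, h3, h4, rfl⟩ := hd
    obtain ⟨i', j', h1', h2', h3', h4', rfl⟩ := hd'
    obtain ⟨a1, a2⟩ := (piece_coord p q a hp0 hq0 _ _).1 e.symm
    obtain ⟨b1, b2⟩ := (piece_coord p q a hp0 hq0 _ _).1 e'.symm
    simp at a1 b1 a2 b2 hd0 hd0'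
    subst hd0
    have hdx := dx_bound p q m a hp hq hm2 hz hz'
    have hx0 : z 0 - z' 0 = ((i' : ℤ) : ℝ) := by
      push_cast at a1; linarith
    have hi1 : i' = 1 := by
      rw [hx0] at hdx
      have : |i'| < 2 := by exact_mod_cast hdx
      rw [abs_lt] at this
      omega
    subst hi1
    push_cast at hx0
    have hy0 : z 1 - z' 1 = (j' : ℝ) - j := by linarith
    have hj := digit_diff h3' h4' h3 h4
    rw [Int.cast_abs, ← hy0] at hj
    -- next level
    obtain ⟨x', hx', _, ⟨k, l, g1, g2, g3, g4, rfl⟩, ex⟩ := T_exists p q m a hp hq hz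
    obtain ⟨y', hy', _, ⟨k', l', g1', g2', g3', g4', rfl⟩, ey⟩ := T_exists p q m a hp hq hz'
    obtain ⟨c1, c2⟩ := (piece_coord p q a hp0 hq0 _ _).1 ex
    obtain ⟨f1, f2⟩ := (piece_coord p q a hp0 hq0 _ _).1 ey
    simp at c1 c2 f1 f2
    have hb := dy_bound p q m a hp hq hm2 hx' hy' ⟨p - (k - k'), by
      have h5 : (p : ℝ) * (z 0 - z' 0) = p := by rw [hx0, mul_one]
      push_cast; linarith⟩
    have hl := digit_diff g3 g4 g3' g4'
    rw [Int.cast_abs] at hl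
    have ha : a = q * (z 1 - z' 1) - ((x' 1 - y' 1) + ((l : ℝ) - l')) := by
      have : a * (z 0 - z' 0) = a := by rw [hx0, mul_one]
      linarith
    have ha' : |a| ≤ |(q : ℝ)| * (|(q : ℝ)| - 1) +
        ((|a| + (|(q : ℝ)| - 1)) / (|(q : ℝ)| - 1) + (|(q : ℝ)| - 1)) := by
      conv_lhs => rw [ha]
      refine (abs_sub _ _).trans (add_le_add ?_ ((abs_add_le _ _).trans (add_le_add hb hl)))
      rw [abs_mul]
      gcongr
    rw [← sq_abs (q : ℝ)]
    set s := |(q : ℝ)|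
    rw [le_div_iff₀ (by linarith)]
    have hs : s - 1 ≠ 0 := by linarith
    have e1 : (|a| + (s - 1)) / (s - 1) * (s - 1) = |a| + (s - 1) := by field_simp
    have := mul_le_mul_of_nonneg_right ha' (show 0 ≤ s - 1 by linarith)
    rw [add_mul, add_mul, e1] at this
    nlinarith
  · intro x hx
    obtain ⟨z, hz, d, hd, rfl⟩ := T_exists p q m a hp hq hx
    by_cases h : d 0 = 0
    · exact Or.inl ⟨(z, d), ⟨hz, hd, h⟩, rfl⟩
    · exact Or.inr ⟨(z, d), ⟨hz, hd, h⟩, rfl⟩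
  · have h0 : (0 : Fin 2 → ℝ) ∈ digitSet m |q| := digit_zero (by omega) hq1
    exact ⟨_, T_mem_of p q m a hT0 h0, (0, 0), ⟨hT0, h0, rfl⟩, rfl⟩
  · have h0 : (![((1 : ℤ) : ℝ), ((0 : ℤ) : ℝ)] : Fin 2 → ℝ) ∈ digitSet m |q| :=
      ⟨1, 0, by omega, by omega, le_rfl, by omega, rfl⟩
    exact ⟨_, T_mem_of p q m a hT0 h0, (0, _), ⟨hT0, h0,
      (by simp : (![((1 : ℤ) : ℝ), ((0 : ℤ) : ℝ)] : Fin 2 → ℝ) 0 ≠ 0)⟩, rfl⟩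

lemma round_exists (n : ℤ) (hn : 1 ≤ n) (u : ℝ) (hu : |u| ≤ n) :
    ∃ j : ℤ, |j| ≤ n - 1 ∧ |u - j| ≤ 1 := by
  rw [abs_le] at hu
  rcases lt_trichotomy u 0 with h | h | h
  · refine ⟨⌊u⌋ + 1, ?_, ?_⟩
    · have h1 : -n ≤ ⌊u⌋ := by rw [Int.le_floor]; push_cast; linarith
      have h2 : ⌊u⌋ < 0 := by rw [Int.floor_lt]; simpa using h
      rw [abs_le]; constructor <;> omega
    · have h1 := Int.floor_le u
      have h2 := Int.lt_floor_add_one u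
      push_cast
      rw [abs_le]; constructor <;> linarith
  · exact ⟨0, by simpa using hn, by simp [h]⟩
  · refine ⟨⌈u⌉ - 1, ?_, ?_⟩
    · have h1 : ⌈u⌉ ≤ n := by rw [Int.ceil_le]; linarith
      have h2 : 0 < ⌈u⌉ := by rw [Int.lt_ceil]; simpa using h
      rw [abs_le]; constructor <;> omega
    · have h1 := Int.le_ceil u
      have h2 := Int.ceil_lt_add_one u
      push_cast
      rw [abs_le]; constructor <;> linarith

lemma diff_digit (m n e f : ℤ) (he : |e| ≤ m - 1) (hf : |f| ≤ n - 1) :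
    ∃ d ∈ digitSet m n, ∃ d' ∈ digitSet m n, d - d' = ![(e : ℝ), (f : ℝ)] := by
  rw [abs_le] at he hf
  refine ⟨![((max e 0 : ℤ) : ℝ), ((max f 0 : ℤ) : ℝ)],
    ⟨_, _, by omega, by omega, by omega, by omega, rfl⟩,
    ![((max e 0 - e : ℤ) : ℝ), ((max f 0 - f : ℤ) : ℝ)],
    ⟨_, _, by omega, by omega, by omega, by omega, rfl⟩, ?_⟩
  ext t
  fin_cases t <;> simp

lemma sufficient (p q m : ℤ) (a : ℝ) (hp : (2 : ℝ) ≤ |(p : ℝ)|) (hq : (3 : ℝ) ≤ |(q : ℝ)|)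
    (hm : |p| + 1 < m)
    (ha : |a| ≤ (q : ℝ) ^ 2 * (|(q : ℝ)| - 1) / (|(q : ℝ)| - 2)) :
    IsPreconnected (T p q m a) := by
  have hp0 : (p : ℝ) ≠ 0 := by intro h; rw [h] at hp; norm_num at hp
  have hq0 : (q : ℝ) ≠ 0 := by intro h; rw [h] at hq; norm_num at hq
  have hq1 : 1 ≤ |q| := by
    have : (3 : ℝ) ≤ ((|q| : ℤ) : ℝ) := by rw [Int.cast_abs]; exact hq
    have : (3 : ℤ) ≤ |q| := by exact_mod_cast this
    omega
  obtain ⟨σ, hσ, hσq⟩ : ∃ σ : ℤ, |σ| = 1 ∧ (q : ℝ) = σ * |(q : ℝ)| := by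
    rcases abs_choice (q : ℝ) with h | h
    · exact ⟨1, by simp, by rw [h]; simp⟩
    · exact ⟨-1, by simp, by rw [h]; simp⟩
  have hσ2 : (σ : ℝ) * σ = 1 := by
    have : σ * σ = 1 := by rw [← abs_mul_abs_self, hσ]; rfl
    exact_mod_cast this
  set s := |(q : ℝ)| with hs
  have hs1 : s - 1 ≠ 0 := by linarith
  have hσ0 : (σ : ℝ) ≠ 0 := by intro h; rw [h] at hσ2; norm_num at hσ2
  let E : Set (Fin 2 → ℝ) := {v |
    (∃ x : ℤ, |x| ≤ 1 ∧ v 0 = x ∧ |v 1 - a * σ * x / (s - 1)| ≤ 1) ∨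
    (v 0 = 1 ∧ |v 1 - a * (s - 2) / (q * (s - 1))| ≤ 1)}
  -- one step
  have hstep : ∀ (v : Fin 2 → ℝ) (x e x' : ℤ) (g : ℝ), v 0 = x → |v 1 - g| ≤ 1 → |e| ≤ m - 1 →
      |x'| ≤ 1 → p * x = x' + e → q * g = a * x + a * σ * x' / (s - 1) →
      ∃ w ∈ E, ∃ d ∈ digitSet m |q|, ∃ d' ∈ digitSet m |q|,
      v = B p q a *ᵥ (w + (d - d')) := by
    intro v x e x' g hv hg he hx' hpx hqg
    obtain ⟨j, hj, hj2⟩ := round_exists |q| hq1 (q * (v 1 - g)) (by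
      rw [abs_mul, Int.cast_abs]; nlinarith [abs_nonneg (q : ℝ)])
    obtain ⟨d, hd, d', hd', hdd⟩ := diff_digit m |q| e j he hj
    refine ⟨![(x' : ℝ), q * v 1 - a * x - j], Or.inl ⟨x', hx', by simp, ?_⟩, d, hd, d', hd', ?_⟩
    · have : (![(x' : ℝ), q * v 1 - a * x - j] : Fin 2 → ℝ) 1 - a * σ * x' / (s - 1) =
          q * (v 1 - g) - j := by
        simp only [Matrix.cons_val_one, Matrix.cons_val_fin_one]; linarith
      rw [this]; exact hj2
    · rw [piece_coord p q a hp0 hq0, hdd, hv]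
      have hpx' : (p : ℝ) * x = x' + e := by exact_mod_cast hpx
      constructor
      · simpa using hpx'
      · simp
  have hE : ∀ v ∈ E, ∃ w ∈ E, ∃ d ∈ digitSet m |q|, ∃ d' ∈ digitSet m |q|,
      v = B p q a *ᵥ (w + (d - d')) := by
    rintro v (⟨x, hx, hv0, hv1⟩ | ⟨hv0, hv1⟩)
    · refine hstep v x ((p - σ) * x) (σ * x) _ hv0 hv1 ?_ ?_ (by ring) ?_
      · rw [abs_mul]
        have : |p - σ| ≤ |p| + 1 := by rw [← hσ]; exact abs_sub _ _
        nlinarith [abs_nonneg (p - σ), abs_nonneg x]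
      · rw [abs_mul, hσ, one_mul]; exact hx
      · push_cast
        rw [show a * (σ : ℝ) * (σ * x) = a * x * (σ * σ) by ring, hσ2]
        rw [show (q : ℝ) * (a * σ * x / (s - 1)) = a * x * (σ * σ) * s / (s - 1) by
          rw [hσq]; ring, hσ2]
        field_simp
        ring
    · refine hstep v 1 (p + σ) (-σ) _ (by simpa using hv0) hv1 ?_ ?_ (by ring) ?_
      · have : |p + σ| ≤ |p| + 1 := by rw [← hσ]; exact abs_add_le _ _
        omega
      · rw [abs_neg, hσ]
      · push_cast
        rw [show a * (σ : ℝ) * -σ = -a * (σ * σ) by ring, hσ2]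
        field_simp
        ring
  have hEb : ∀ v ∈ E, ‖v‖ ≤ 1 + (1 + |a| * |(σ : ℝ)| / |s - 1|) +
      (1 + |a * (s - 2) / (q * (s - 1))|) := by
    rintro v (⟨x, hx, hv0, hv1⟩ | ⟨hv0, hv1⟩)
    · have hx' : |(x : ℝ)| ≤ 1 := by exact_mod_cast hx
      have p1 := abs_nonneg (a * (s - 2) / (q * (s - 1)))
      have p2 : 0 ≤ |a| * |(σ : ℝ)| / |s - 1| := by positivity
      rw [pi_norm_le_iff_of_nonneg (by positivity)]
      intro t
      fin_cases t
      · simp only [Fin.zero_eta, hv0, Real.norm_eq_abs]; linarith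
      · have h1 : |a * σ * x / (s - 1)| ≤ |a| * |(σ : ℝ)| / |s - 1| := by
          rw [abs_div, abs_mul, abs_mul]
          apply div_le_div_of_nonneg_right _ (abs_nonneg _)
          exact mul_le_of_le_one_right (by positivity) hx'
        have h2 := abs_add_le (v 1 - a * σ * x / (s - 1)) (a * σ * x / (s - 1))
        rw [sub_add_cancel] at h2
        simp only [Fin.mk_one, Real.norm_eq_abs]
        linarith
    · have p1 := abs_nonneg (a * (s - 2) / (q * (s - 1)))
      have p2 : 0 ≤ |a| * |(σ : ℝ)| / |s - 1| := by positivity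
      rw [pi_norm_le_iff_of_nonneg (by positivity)]
      intro t
      fin_cases t
      · simp only [Fin.zero_eta, hv0, Real.norm_eq_abs, abs_one]; linarith
      · have h2 := abs_add_le (v 1 - a * (s - 2) / (q * (s - 1))) (a * (s - 2) / (q * (s - 1)))
        rw [sub_add_cancel] at h2
        simp only [Fin.mk_one, Real.norm_eq_abs]
        linarith
  have hdm := diff_mem p q m a hp hq E _ hEb hE
  apply chain_connected p q m a hp hq
  apply chains p q m a hp hq (by have := abs_nonneg p; omega)
  · apply hdm
    exact Or.inl ⟨0, by simp, by simp, by simp⟩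
  · obtain ⟨j, hj, hj2⟩ := round_exists |q| hq1 (a * (s - 2) / (q * (s - 1))) (by
      rw [Int.cast_abs, ← hs, abs_div, abs_mul, abs_mul, ← hs, abs_of_pos (by linarith : 0 < s - 2),
        abs_of_pos (by linarith : 0 < s - 1)]
      rw [le_div_iff₀ (by linarith), ← sq_abs, ← hs] at ha
      rw [div_le_iff₀ (mul_pos (by linarith) (by linarith))]
      linarith)
    refine ⟨j, hj, hdm _ (Or.inr ⟨by simp, ?_⟩)⟩
    rw [abs_sub_comm]
    simpa using hj2

end SelfAff

theorem stmt_2 (p q m : ℤ) (a : ℝ) (hp : 2 ≤ |p|) (hq : 3 ≤ |q|)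
    (hm1 : |p| + 1 < m) (hm2 : m < 2 * |p| - 1) :
    IsConnected (selfAffineSet (matA p q a) (digitSet m |q|)) ↔
      |a| ≤ (q : ℝ) ^ 2 * ((|q| : ℝ) - 1) / ((|q| : ℝ) - 2) := by
  have hp' : (2 : ℝ) ≤ |(p : ℝ)| := by exact_mod_cast hp
  have hq' : (3 : ℝ) ≤ |(q : ℝ)| := by exact_mod_cast hq
  have hm2' : (m : ℝ) < 2 * |(p : ℝ)| - 1 := by exact_mod_cast hm2
  have hp0 : (p : ℝ) ≠ 0 := by intro h; rw [h] at hp'; norm_num at hp'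
  have hq0 : (q : ℝ) ≠ 0 := by intro h; rw [h] at hq'; norm_num at hq'
  have hT : selfAffineSet (matA p q a) (digitSet m |q|) = SelfAff.T p q m a := by
    unfold selfAffineSet SelfAff.T
    rw [SelfAff.matA_inv p q a hp0 hq0]
  rw [hT]
  constructor
  · intro h
    exact SelfAff.necessary p q m a hp' hq' (by omega) hm2' h.isPreconnected
  · intro h
    exact ⟨⟨0, SelfAff.T_zero p q m a (by omega) (by omega)⟩,
      SelfAff.sufficient p q m a hp' hq' hm1 h⟩
end

section
/- Let p, q, m, n be integers with p ≥ 2, |q| ≥ 3, p + 1 < m < 2p − 1, and 2n − 1 ≥ |q|, and let a ∈ ℝ. Then the following two conditions hold simultaneously — (1) G_i(T) ∩ G_{i+1}(T) ≠ ∅ for every i ∈ {0, …, m−2}, and (2) S_{i,j}(T) ∩ S_{i,j+1}(T) ≠ ∅ for every i ∈ {0, …, m−1} and every j ∈ {0, …, n−2} — if and only if |q|(|q| − n) ≤ |a| ≤ q²(n−1)/(|q|−2). -/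
open Matrix

/-- `S_{i,j}(T) = A⁻¹(T + (i, j))`. -/
noncomputable def Sij (A : Matrix (Fin 2) (Fin 2) ℝ) (T : Set (Fin 2 → ℝ)) (i j : ℤ) :
    Set (Fin 2 → ℝ) :=
  (fun x => A⁻¹.mulVec (x + ![(i : ℝ), (j : ℝ)])) '' T

noncomputable def Gi (A : Matrix (Fin 2) (Fin 2) ℝ) (T : Set (Fin 2 → ℝ)) (n i : ℤ) :
    Set (Fin 2 → ℝ) :=
  ⋃ j ∈ Set.Icc (0 : ℤ) (n - 1), Sij A T i j

/-- Bounded orbits of the difference system, in coordinates. -/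
def Orb (p q m n : ℤ) (a z0 z1 : ℝ) : Prop :=
  ∃ s w : ℕ → ℝ, s 0 = z0 ∧ w 0 = z1 ∧ (∃ B : ℝ, ∀ k, |s k| ≤ B ∧ |w k| ≤ B) ∧
    ∀ k, ∃ e f : ℤ, |e| ≤ m - 1 ∧ |f| ≤ n - 1 ∧ s (k + 1) = p * s k - e ∧
      w (k + 1) = q * w k - a * s k - f

theorem matA_inv (p q : ℤ) (a : ℝ) (hp : (p : ℝ) ≠ 0) (hq : (q : ℝ) ≠ 0) :
    (matA p q a)⁻¹ = !![1 / (p : ℝ), 0; a / (p * q), 1 / (q : ℝ)] := by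
  apply Matrix.inv_eq_right_inv
  ext i j
  fin_cases i <;> fin_cases j <;> simp [matA, Matrix.mul_apply, Fin.sum_univ_two] <;> field_simp
  ring

theorem matA_det (p q : ℤ) (a : ℝ) (hp : (p : ℝ) ≠ 0) (hq : (q : ℝ) ≠ 0) :
    IsUnit (matA p q a).det := by
  simp [matA, Matrix.det_fin_two, hp, hq]

/-- Weighted norm. -/
noncomputable def NN (a : ℝ) (v : Fin 2 → ℝ) : ℝ := (|a| + 1) * |v 0| + |v 1|

theorem norm_le_NN (a : ℝ) (v : Fin 2 → ℝ) : ‖v‖ ≤ NN a v := by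
  have h0 := abs_nonneg (v 0)
  have h1 := abs_nonneg (v 1)
  have ha := abs_nonneg a
  have := mul_nonneg ha h0
  rw [pi_norm_le_iff_of_nonneg (by unfold NN; nlinarith)]
  intro i
  fin_cases i <;> simp [NN, Real.norm_eq_abs] <;> nlinarith

theorem NN_inv (p q : ℤ) (a : ℝ) (hp : 4 ≤ p) (hq : 3 ≤ |q|) (v : Fin 2 → ℝ) :
    NN a ((matA p q a)⁻¹ *ᵥ v) ≤ NN a v / 2 := by
  have hp' : (4 : ℝ) ≤ p := by exact_mod_cast hp
  have hq' : (3 : ℝ) ≤ |(q : ℝ)| := by exact_mod_cast hq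
  have hq0 : (q : ℝ) ≠ 0 := by
    intro h; rw [h] at hq'; norm_num at hq'
  rw [matA_inv p q a (by positivity) hq0]
  have h0 := abs_nonneg (v 0)
  have h1 := abs_nonneg (v 1)
  have ha := abs_nonneg a
  have hah := mul_nonneg ha h0
  have ip : (p : ℝ)⁻¹ ≤ 1 / 4 := by
    rw [inv_le_comm₀ (by positivity) (by norm_num)]; simpa using hp'
  have iq : |(q : ℝ)|⁻¹ ≤ 1 / 3 := by
    rw [inv_le_comm₀ (by positivity) (by norm_num)]; simpa using hq'
  have ip0 : 0 ≤ (p : ℝ)⁻¹ := by positivity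
  have iq0 : 0 ≤ |(q : ℝ)|⁻¹ := by positivity
  have e0 : |(p : ℝ)⁻¹ * v 0| ≤ |v 0| / 4 := by
    rw [abs_mul, abs_of_nonneg ip0]; nlinarith
  have e1 : |a / (p * q) * v 0 + (q : ℝ)⁻¹ * v 1| ≤ |a| * |v 0| / 12 + |v 1| / 3 := by
    refine (abs_add_le _ _).trans ?_
    have hx : |a / (p * q) * v 0| = ((p : ℝ)⁻¹ * |(q : ℝ)|⁻¹) * (|a| * |v 0|) := by
      rw [abs_mul, abs_div, abs_mul, abs_of_nonneg (by positivity : (0 : ℝ) ≤ p)]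
      field_simp
    have hy : |(q : ℝ)⁻¹ * v 1| = |(q : ℝ)|⁻¹ * |v 1| := by rw [abs_mul, abs_inv]
    have hz : (p : ℝ)⁻¹ * |(q : ℝ)|⁻¹ ≤ 1 / 12 := by nlinarith
    rw [hx, hy]
    nlinarith
  have g0 : (!![1 / (p : ℝ), 0; a / (p * q), 1 / (q : ℝ)] *ᵥ v) 0 = (p : ℝ)⁻¹ * v 0 := by
    simp [Matrix.mulVec, dotProduct, Fin.sum_univ_two]
  have g1 : (!![1 / (p : ℝ), 0; a / (p * q), 1 / (q : ℝ)] *ᵥ v) 1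
      = a / (p * q) * v 0 + (q : ℝ)⁻¹ * v 1 := by
    simp [Matrix.mulVec, dotProduct, Fin.sum_univ_two]
  unfold NN
  rw [g0, g1]
  nlinarith

theorem NN_pow (p q : ℤ) (a : ℝ) (hp : 4 ≤ p) (hq : 3 ≤ |q|) (v : Fin 2 → ℝ) (k : ℕ) :
    NN a (((matA p q a)⁻¹ ^ k) *ᵥ v) ≤ NN a v * (1 / 2) ^ k := by
  induction k with
  | zero => simp
  | succ k ih =>
    rw [pow_succ', ← Matrix.mulVec_mulVec]
    refine (NN_inv p q a hp hq _).trans ?_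
    rw [pow_succ]
    linarith

theorem NN_digit (m n : ℤ) (a : ℝ) (d : Fin 2 → ℝ) (hd : d ∈ digitSet m n) :
    NN a d ≤ (|a| + 1) * m + n := by
  obtain ⟨i, j, hi, hi', hj, hj', rfl⟩ := hd
  have h1 : (0 : ℝ) ≤ i := by exact_mod_cast hi
  have h2 : (0 : ℝ) ≤ j := by exact_mod_cast hj
  have h3 : (i : ℝ) ≤ m := by exact_mod_cast (by omega : i ≤ m)
  have h4 : (j : ℝ) ≤ n := by exact_mod_cast (by omega : j ≤ n)
  have ha := abs_nonneg a
  simp only [NN, Matrix.cons_val_zero, Matrix.cons_val_one, abs_of_nonneg h1, abs_of_nonneg h2]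
  nlinarith

theorem geo_sum (C : ℝ) : HasSum (fun k : ℕ => C * (1 / 2 : ℝ) ^ (k + 1)) C := by
  have := (hasSum_geometric_two).mul_left (C * (1 / 2))
  have e1 : (fun k : ℕ => C * (1 / 2 : ℝ) ^ (k + 1)) = fun k => C * (1 / 2) * (1 / 2) ^ k := by
    funext k; rw [pow_succ]; ring
  have e2 : C * (1 / 2) * 2 = C := by ring
  rw [e2] at this
  rw [e1]
  exact this

theorem T_term (p q m n : ℤ) (a : ℝ) (hp : 4 ≤ p) (hq : 3 ≤ |q|) (d : ℕ → Fin 2 → ℝ)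
    (hd : ∀ k, d k ∈ digitSet m n) (k : ℕ) :
    ‖((matA p q a)⁻¹ ^ (k + 1)) *ᵥ (d k)‖ ≤ ((|a| + 1) * m + n) * (1 / 2 : ℝ) ^ (k + 1) := by
  refine (norm_le_NN a _).trans ((NN_pow p q a hp hq _ _).trans ?_)
  have := NN_digit m n a _ (hd k)
  gcongr

theorem T_bdd (p q m n : ℤ) (a : ℝ) (hp : 4 ≤ p) (hq : 3 ≤ |q|) (x : Fin 2 → ℝ)
    (hx : x ∈ selfAffineSet (matA p q a) (digitSet m n)) : ‖x‖ ≤ (|a| + 1) * m + n := by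
  obtain ⟨d, hd, hs⟩ := hx
  exact hs.norm_le_of_bounded (geo_sum _) (T_term p q m n a hp hq d hd)

theorem T_step (p q m n : ℤ) (a : ℝ) (hp : 4 ≤ p) (hq : 3 ≤ |q|) (x : Fin 2 → ℝ)
    (hx : x ∈ selfAffineSet (matA p q a) (digitSet m n)) :
    ∃ d ∈ digitSet m n, matA p q a *ᵥ x - d ∈ selfAffineSet (matA p q a) (digitSet m n) := by
  have hp0 : (p : ℝ) ≠ 0 := by exact_mod_cast (by omega : p ≠ 0)
  have hq0 : (q : ℝ) ≠ 0 := by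
    have : q ≠ 0 := by rintro rfl; simp at hq
    exact_mod_cast this
  have hu := matA_det p q a hp0 hq0
  obtain ⟨d, hd, hs⟩ := hx
  refine ⟨d 0, hd 0, fun k => d (k + 1), fun k => hd _, ?_⟩
  have h1 := (hasSum_nat_add_iff' 1).mpr hs
  have h2 := h1.map (Matrix.mulVecLin (matA p q a))
    (LinearMap.continuous_of_finiteDimensional _)
  convert h2 using 1
  · ext1 k
    simp only [Function.comp, Matrix.mulVecLin_apply]
    rw [Matrix.mulVec_mulVec, pow_succ' _ (k + 1), ← Matrix.mul_assoc,
      Matrix.mul_nonsing_inv _ hu, Matrix.one_mul]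
  · simp only [Finset.sum_range_one, Matrix.mulVecLin_apply, Matrix.mulVec_sub, zero_add, pow_one]
    rw [Matrix.mulVec_mulVec, Matrix.mul_nonsing_inv _ hu, Matrix.one_mulVec]

theorem matA_mulVec (p q : ℤ) (a : ℝ) (v : Fin 2 → ℝ) :
    matA p q a *ᵥ v = ![p * v 0, -a * v 0 + q * v 1] := by
  ext i
  fin_cases i <;> simp [matA, Matrix.mulVec, dotProduct, Fin.sum_univ_two]

theorem split_digit (m e : ℤ) (h : |e| ≤ m - 1) :
    ∃ i j : ℤ, 0 ≤ i ∧ i ≤ m - 1 ∧ 0 ≤ j ∧ j ≤ m - 1 ∧ i - j = e := by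
  rw [abs_le] at h
  rcases le_total 0 e with h0 | h0
  · exact ⟨e, 0, by omega, by omega, by omega, by omega, by omega⟩
  · exact ⟨0, -e, by omega, by omega, by omega, by omega, by omega⟩

theorem diff_iff (p q m n : ℤ) (a : ℝ) (hp : 4 ≤ p) (hq : 3 ≤ |q|) (z0 z1 : ℝ) :
    (∃ x ∈ selfAffineSet (matA p q a) (digitSet m n),
      ∃ y ∈ selfAffineSet (matA p q a) (digitSet m n), x - y = ![z0, z1]) ↔
      Orb p q m n a z0 z1 := by
  have hp0 : (p : ℝ) ≠ 0 := by exact_mod_cast (by omega : p ≠ 0)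
  have hq0 : (q : ℝ) ≠ 0 := by
    have : q ≠ 0 := by rintro rfl; simp at hq
    exact_mod_cast this
  have hu := matA_det p q a hp0 hq0
  constructor
  · rintro ⟨x, hx, y, hy, hxy⟩
    have hT := T_step p q m n a hp hq
    choose! dg hdg hnx using hT
    have hmem : ∀ x ∈ selfAffineSet (matA p q a) (digitSet m n), ∀ k : ℕ,
        (fun x => matA p q a *ᵥ x - dg x)^[k] x ∈ selfAffineSet (matA p q a) (digitSet m n) := by
      intro x hx k
      induction k with
      | zero => exact hx
      | succ k ih => rw [Function.iterate_succ_apply']; exact hnx _ ih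
    set g := (fun x => matA p q a *ᵥ x - dg x) with hg
    refine ⟨fun k => (g^[k] x - g^[k] y) 0, fun k => (g^[k] x - g^[k] y) 1, ?_, ?_, ?_, ?_⟩
    · simpa using congrFun hxy 0
    · simpa using congrFun hxy 1
    · refine ⟨2 * ((|a| + 1) * m + n), fun k => ?_⟩
      have hb : ‖g^[k] x - g^[k] y‖ ≤ 2 * ((|a| + 1) * m + n) := by
        have h1 := T_bdd p q m n a hp hq _ (hmem x hx k)
        have h2 := T_bdd p q m n a hp hq _ (hmem y hy k)
        have := norm_sub_le (g^[k] x) (g^[k] y)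
        linarith
      exact ⟨(norm_le_pi_norm (g^[k] x - g^[k] y) 0).trans hb,
        (norm_le_pi_norm (g^[k] x - g^[k] y) 1).trans hb⟩
    · intro k
      obtain ⟨i, j, hi, hi', hj, hj', hd⟩ := hdg _ (hmem x hx k)
      obtain ⟨i2, j2, hi2, hi2', hj2, hj2', hd2⟩ := hdg _ (hmem y hy k)
      refine ⟨i - i2, j - j2, by rw [abs_le]; omega, by rw [abs_le]; omega, ?_, ?_⟩
      · simp only [Function.iterate_succ_apply']
        rw [show g (g^[k] x) = matA p q a *ᵥ (g^[k] x) - dg (g^[k] x) from rfl,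
          show g (g^[k] y) = matA p q a *ᵥ (g^[k] y) - dg (g^[k] y) from rfl, hd, hd2]
        simp only [matA_mulVec, Pi.sub_apply]
        simp
        ring
      · simp only [Function.iterate_succ_apply']
        rw [show g (g^[k] x) = matA p q a *ᵥ (g^[k] x) - dg (g^[k] x) from rfl,
          show g (g^[k] y) = matA p q a *ᵥ (g^[k] y) - dg (g^[k] y) from rfl, hd, hd2]
        simp only [matA_mulVec, Pi.sub_apply]
        simp
        ring
  · rintro ⟨s, w, hs0, hw0, ⟨B, hB⟩, hst⟩
    choose e f he hf hse hwf using hst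
    choose i i' hi1 hi2 hi3 hi4 hi using fun k => split_digit m _ (he k)
    choose j j' hj1 hj2 hj3 hj4 hj using fun k => split_digit n _ (hf k)
    have hd1 : ∀ k, ![(i k : ℝ), (j k : ℝ)] ∈ digitSet m n := fun k =>
      ⟨i k, j k, hi1 k, hi2 k, hj1 k, hj2 k, rfl⟩
    have hd2 : ∀ k, ![(i' k : ℝ), (j' k : ℝ)] ∈ digitSet m n := fun k =>
      ⟨i' k, j' k, hi3 k, hi4 k, hj3 k, hj4 k, rfl⟩
    have sm : ∀ d : ℕ → Fin 2 → ℝ, (∀ k, d k ∈ digitSet m n) →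
        Summable (fun k => ((matA p q a)⁻¹ ^ (k + 1)) *ᵥ (d k)) := fun d hd =>
      Summable.of_norm_bounded (geo_sum _).summable (T_term p q m n a hp hq d hd)
    obtain ⟨x, hx⟩ := sm _ hd1
    obtain ⟨y, hy⟩ := sm _ hd2
    refine ⟨x, ⟨_, hd1, hx⟩, y, ⟨_, hd2, hy⟩, ?_⟩
    have hlim := (hx.sub hy).tendsto_sum_nat
    have hps : ∀ K : ℕ, ∑ k ∈ Finset.range K,
        (((matA p q a)⁻¹ ^ (k + 1)) *ᵥ ![(i k : ℝ), (j k : ℝ)]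
          - ((matA p q a)⁻¹ ^ (k + 1)) *ᵥ ![(i' k : ℝ), (j' k : ℝ)])
        = ![z0, z1] - ((matA p q a)⁻¹ ^ K) *ᵥ ![s K, w K] := by
      intro K
      induction K with
      | zero => simp [hs0, hw0]
      | succ K ih =>
        rw [Finset.sum_range_succ, ih, ← Matrix.mulVec_sub]
        have h1 : ![(i K : ℝ), (j K : ℝ)] - ![(i' K : ℝ), (j' K : ℝ)]
            = matA p q a *ᵥ ![s K, w K] - ![s (K + 1), w (K + 1)] := by
          have t1 : (i K : ℝ) - i' K = e K := by exact_mod_cast hi K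
          have t2 : (j K : ℝ) - j' K = f K := by exact_mod_cast hj K
          rw [matA_mulVec]
          ext r
          fin_cases r
          · simp [hse, t1]
          · simp [hwf, t2]; ring
        rw [h1, Matrix.mulVec_sub, Matrix.mulVec_mulVec ![s K, w K], pow_succ, Matrix.mul_assoc,
          Matrix.nonsing_inv_mul _ hu, Matrix.mul_one]
        abel
    simp only [hps] at hlim
    have hz : Filter.Tendsto (fun K : ℕ => ((matA p q a)⁻¹ ^ K) *ᵥ ![s K, w K])
        Filter.atTop (nhds 0) := by
      apply squeeze_zero_norm (a := fun K : ℕ => ((|a| + 1) * B + B) * (1 / 2 : ℝ) ^ K)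
      · intro K
        refine (norm_le_NN a _).trans ((NN_pow p q a hp hq _ _).trans ?_)
        have : NN a ![s K, w K] ≤ (|a| + 1) * B + B := by
          simp only [NN, Matrix.cons_val_zero, Matrix.cons_val_one]
          have := (hB K).1
          have := (hB K).2
          gcongr
        gcongr
      · have := (tendsto_pow_atTop_nhds_zero_of_lt_one (r := (1 / 2 : ℝ)) (by norm_num)
          (by norm_num)).const_mul ((|a| + 1) * B + B)
        simpa using this
    have hl2 := hz.const_sub ![z0, z1]
    rw [sub_zero] at hl2
    exact tendsto_nhds_unique hlim hl2

theorem S_iff (p q m n : ℤ) (a : ℝ) (hp : 4 ≤ p) (hq : 3 ≤ |q|) (i j i' j' : ℤ) :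
    (Sij (matA p q a) (selfAffineSet (matA p q a) (digitSet m n)) i j ∩
      Sij (matA p q a) (selfAffineSet (matA p q a) (digitSet m n)) i' j').Nonempty ↔
      Orb p q m n a (i' - i) (j' - j) := by
  have hp0 : (p : ℝ) ≠ 0 := by exact_mod_cast (by omega : p ≠ 0)
  have hq0 : (q : ℝ) ≠ 0 := by
    have : q ≠ 0 := by rintro rfl; simp at hq
    exact_mod_cast this
  have hu := matA_det p q a hp0 hq0
  rw [← diff_iff p q m n a hp hq]
  have hvec : ∀ x y : Fin 2 → ℝ, x - y = ![(i' : ℝ) - i, (j' : ℝ) - j] ↔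
      x + ![(i : ℝ), (j : ℝ)] = y + ![(i' : ℝ), (j' : ℝ)] := by
    intro x y
    have : ![(i' : ℝ) - i, (j' : ℝ) - j] = ![(i' : ℝ), (j' : ℝ)] - ![(i : ℝ), (j : ℝ)] := by
      simp
    rw [this, sub_eq_sub_iff_add_eq_add, add_comm ![(i' : ℝ), (j' : ℝ)]]
  constructor
  · rintro ⟨_, ⟨x, hx, rfl⟩, ⟨y, hy, hxy⟩⟩
    refine ⟨x, hx, y, hy, ?_⟩
    rw [hvec]
    have := congrArg (fun v => matA p q a *ᵥ v) hxy
    simp only [Matrix.mulVec_mulVec, Matrix.mul_nonsing_inv _ hu, Matrix.one_mulVec] at this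
    exact this.symm
  · rintro ⟨x, hx, y, hy, hxy⟩
    rw [hvec] at hxy
    refine ⟨_, ⟨x, hx, rfl⟩, ⟨y, hy, ?_⟩⟩
    simp only [hxy]

theorem grow (u : ℕ → ℝ) (Q c B : ℝ) (hQ : 2 ≤ Q) (hB : ∀ k, u k ≤ B)
    (h : ∀ k, Q * u k - c ≤ u (k + 1)) (k : ℕ) : (Q - 1) * u k ≤ c := by
  by_contra hc
  push Not at hc
  set δ := (Q - 1) * u k - c with hδ
  have hδ0 : 0 < δ := by linarith
  have key : ∀ t : ℕ, u k + t * δ ≤ u (k + t) := by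
    intro t
    induction t with
    | zero => simp
    | succ t ih =>
      have h1 := h (k + t)
      have ht : (0 : ℝ) ≤ t * δ := by positivity
      have h2 : u k ≤ u (k + t) := by linarith
      have h3 : (Q - 1) * u k ≤ (Q - 1) * u (k + t) := by
        apply mul_le_mul_of_nonneg_left h2; linarith
      push_cast
      rw [← add_assoc]
      nlinarith
  obtain ⟨t, ht⟩ := exists_nat_gt ((B - u k) / δ)
  rw [div_lt_iff₀ hδ0] at ht
  have := key t
  have := hB (k + t)
  linarith

/-- Necessary condition on the first step of an orbit. -/
theorem orb_nec (p q m n : ℤ) (a : ℝ) (hp : 4 ≤ p) (hq : 3 ≤ |q|) (hm2 : m < 2 * p - 1)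
    (z0 : ℤ) (z1 : ℝ) (h : Orb p q m n a z0 z1) :
    ∃ f : ℤ, |f| ≤ n - 1 ∧
      (|(q : ℝ)| - 1) * |q * z1 - a * z0 - f| ≤ |a| + (n - 1) := by
  obtain ⟨s, w, hs0, hw0, ⟨B, hB⟩, hst⟩ := h
  have hp' : (4 : ℝ) ≤ p := by exact_mod_cast hp
  have hq' : (3 : ℝ) ≤ |(q : ℝ)| := by exact_mod_cast hq
  have hsint : ∀ k, ∃ z : ℤ, s k = z := by
    intro k
    induction k with
    | zero => exact ⟨z0, hs0⟩
    | succ k ih =>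
      obtain ⟨z, hz⟩ := ih
      obtain ⟨e, f, -, -, h1, -⟩ := hst k
      exact ⟨p * z - e, by rw [h1, hz]; push_cast; ring⟩
  have hsb : ∀ k, (p - 1 : ℝ) * |s k| ≤ m - 1 := by
    intro k
    refine grow (fun k => |s k|) p (m - 1) B (by linarith) (fun k => (hB k).1) ?_ k
    intro k
    obtain ⟨e, f, he, -, h1, -⟩ := hst k
    have he' : |(e : ℝ)| ≤ m - 1 := by exact_mod_cast he
    have h2 := abs_sub_abs_le_abs_sub (p * s k) (e : ℝ)
    rw [← h1, abs_mul, abs_of_nonneg (by linarith : (0 : ℝ) ≤ p)] at h2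
    show p * |s k| - (m - 1) ≤ |s (k + 1)|
    linarith
  have hs1 : ∀ k, |s k| ≤ 1 := by
    intro k
    obtain ⟨z, hz⟩ := hsint k
    have h1 := hsb k
    rw [hz] at h1 ⊢
    have h2 : (p - 1) * |z| ≤ m - 1 := by exact_mod_cast h1
    have h3 : |z| ≤ 1 := by
      by_contra hc
      push Not at hc
      nlinarith
    exact_mod_cast h3
  obtain ⟨e, f, -, hf, -, h2⟩ := hst 0
  refine ⟨f, hf, ?_⟩
  rw [← hw0, ← hs0, ← h2]
  refine grow (fun k => |w k|) _ _ B (by linarith) (fun k => (hB k).2) ?_ 1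
  intro k
  obtain ⟨e, f, -, hf, -, h2⟩ := hst k
  have hf' : |(f : ℝ)| ≤ n - 1 := by exact_mod_cast hf
  show |(q : ℝ)| * |w k| - (|a| + (n - 1)) ≤ |w (k + 1)|
  have h3 := abs_sub_abs_le_abs_sub (q * w k) (a * s k + f)
  rw [abs_mul, show q * w k - (a * s k + f) = w (k + 1) by rw [h2]; ring] at h3
  have h4 := abs_add_le (a * s k) (f : ℝ)
  rw [abs_mul] at h4
  have h5 := mul_le_mul_of_nonneg_left (hs1 k) (abs_nonneg a)
  linarith

/-- One step of digit choice. -/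
theorem cover (N : ℤ) (hN : 0 ≤ N) (R X : ℝ) (hR : 1 / 2 ≤ R) (hX : |X| ≤ N + R) :
    ∃ f : ℤ, |f| ≤ N ∧ |X - f| ≤ R := by
  rw [abs_le] at hX
  by_cases h1 : round X ≤ N
  · by_cases h2 : -N ≤ round X
    · exact ⟨round X, abs_le.mpr ⟨h2, h1⟩, (abs_sub_round X).trans hR⟩
    · refine ⟨-N, by rw [abs_neg, abs_of_nonneg hN], ?_⟩
      have h3 : ((round X : ℤ) : ℝ) ≤ -N - 1 := by exact_mod_cast (by omega : round X ≤ -N - 1)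
      have h4 := abs_le.mp (abs_sub_round X)
      rw [abs_le]; push_cast
      constructor <;> linarith
  · refine ⟨N, by rw [abs_of_nonneg hN], ?_⟩
    have h3 : (N : ℝ) + 1 ≤ ((round X : ℤ) : ℝ) := by exact_mod_cast (by omega : N + 1 ≤ round X)
    have h4 := abs_le.mp (abs_sub_round X)
    rw [abs_le]
    constructor <;> linarith

theorem cover_seq (q n : ℤ) (hq : 3 ≤ |q|) (hn : |q| ≤ 2 * n - 1) (y : ℝ)
    (hy : |y| ≤ (n - 1) / (|(q : ℝ)| - 1)) :
    ∃ u : ℕ → ℝ, u 0 = y ∧ (∀ k, |u k| ≤ (n - 1) / (|(q : ℝ)| - 1)) ∧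
      ∀ k, ∃ f : ℤ, |f| ≤ n - 1 ∧ u (k + 1) = q * u k - f := by
  have hq' : (3 : ℝ) ≤ |(q : ℝ)| := by exact_mod_cast hq
  have hn' : |(q : ℝ)| ≤ 2 * n - 1 := by exact_mod_cast hn
  set R := ((n : ℝ) - 1) / (|(q : ℝ)| - 1) with hR
  have hR2 : 1 / 2 ≤ R := by
    rw [hR, le_div_iff₀ (by linarith)]; linarith
  have hQR : (|(q : ℝ)| - 1) * R = n - 1 := by
    rw [hR]; field_simp [(by linarith : |(q : ℝ)| - 1 ≠ 0)]
  have hstep : ∀ y : ℝ, |y| ≤ R → ∃ f : ℤ, |f| ≤ n - 1 ∧ |q * y - f| ≤ R := by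
    intro y hy
    refine cover (n - 1) (by omega) R _ hR2 ?_
    rw [abs_mul]; push_cast
    have := mul_le_mul_of_nonneg_left hy (abs_nonneg (q : ℝ))
    linarith
  choose! F hF1 hF2 using hstep
  have hmem : ∀ k : ℕ, |(fun y => q * y - (F y : ℝ))^[k] y| ≤ R := by
    intro k
    induction k with
    | zero => exact hy
    | succ k ih => rw [Function.iterate_succ_apply']; exact hF2 _ ih
  refine ⟨fun k => (fun y => q * y - (F y : ℝ))^[k] y, rfl, hmem, fun k => ?_⟩
  exact ⟨_, hF1 _ (hmem k), by
    simp only [Function.iterate_succ_apply']⟩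

theorem aux_one : (1 : ℕ) = 1 := rfl

/-- Sufficient condition on the first step of an orbit. -/
theorem orb_suf (p q m n : ℤ) (a : ℝ) (hp : 4 ≤ p) (hq : 3 ≤ |q|) (hm1 : p + 1 < m)
    (hn : |q| ≤ 2 * n - 1) (z0 : ℤ) (hz0 : |z0| ≤ 1) (z1 : ℝ) (σ : ℤ) (hσ : |σ| ≤ 1)
    (hX : |q * z1 - a * z0 - a * σ / (|(q : ℝ)| - 1)|
      ≤ (n - 1) + (n - 1) / (|(q : ℝ)| - 1)) : Orb p q m n a z0 z1 := by
  have hq' : (3 : ℝ) ≤ |(q : ℝ)| := by exact_mod_cast hq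
  have hn' : |(q : ℝ)| ≤ 2 * n - 1 := by exact_mod_cast hn
  obtain ⟨f0, hf0, hf0'⟩ := cover (n - 1) (by omega) ((n - 1) / (|(q : ℝ)| - 1)) _
    (by rw [le_div_iff₀ (by linarith)]; linarith) (by push_cast; exact hX)
  obtain ⟨u, hu0, hub, hus⟩ := cover_seq q n hq hn _ hf0'
  obtain ⟨g, hg1, hgq⟩ : ∃ g : ℤ, g * g = 1 ∧ q = g * |q| := by
    rcases abs_cases q with h | h
    · exact ⟨1, by norm_num, by omega⟩
    · exact ⟨-1, by norm_num, by omega⟩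
  have hga : |g| = 1 := by
    have : |g| * |g| = 1 := by rw [← abs_mul, hg1]; rfl
    nlinarith [abs_nonneg g]
  have hg1' : (g : ℝ) * g = 1 := by exact_mod_cast hg1
  have hgq' : (q : ℝ) = g * |(q : ℝ)| := by exact_mod_cast hgq
  set S : ℕ → ℤ := fun k => σ * g * g ^ k with hS
  have hSa : ∀ k, |S k| ≤ 1 := by
    intro k; simp only [hS, abs_mul, abs_pow, hga]; simpa using hσ
  have hSs : ∀ k, S (k + 1) = g * S k := by intro k; simp only [hS, pow_succ]; ring
  set s : ℕ → ℤ := fun k => Nat.casesOn k z0 S with hs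
  have hsa : ∀ k, |s k| ≤ 1 := by
    intro k
    cases k with
    | zero => exact hz0
    | succ k => exact hSa k
  set W : ℕ → ℝ := fun k => u k + a * (S k * g) / (|(q : ℝ)| - 1) with hW
  have hne : |(q : ℝ)| - 1 ≠ 0 := by linarith
  have hWs : ∀ k, ∃ f : ℤ, |f| ≤ n - 1 ∧ W (k + 1) = q * W k - a * S k - f := by
    intro k
    obtain ⟨f, hf, hfu⟩ := hus k
    refine ⟨f, hf, ?_⟩
    simp only [hW, hfu, hSs]
    push_cast
    have e1 : a * (g * S k * g) / (|(q : ℝ)| - 1) = a * S k / (|(q : ℝ)| - 1) := by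
      congr 1; linear_combination (a * S k) * hg1'
    have e2 : (q : ℝ) * (a * (S k * g) / (|(q : ℝ)| - 1))
        = a * S k * |(q : ℝ)| / (|(q : ℝ)| - 1) := by
      rw [← mul_div_assoc]; congr 1
      linear_combination (a * S k * g) * hgq' + (a * S k * |(q : ℝ)|) * hg1'
    rw [mul_add, e1, e2]
    field_simp
    ring
  refine ⟨fun k => s k, fun k => Nat.casesOn k z1 W, rfl, rfl, ?_, ?_⟩
  · refine ⟨1 + |z1| + (n - 1) / (|(q : ℝ)| - 1) + |a|, fun k => ?_⟩
    have hR : (0 : ℝ) ≤ (n - 1) / (|(q : ℝ)| - 1) := by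
      apply div_nonneg <;> linarith
    have h1 : |(s k : ℝ)| ≤ 1 := by exact_mod_cast hsa k
    have ha := abs_nonneg a
    have hz := abs_nonneg z1
    refine ⟨by linarith, ?_⟩
    cases k with
    | zero => show |z1| ≤ _; linarith
    | succ k =>
      show |W k| ≤ _
      have hSr : |(S k : ℝ)| ≤ 1 := by exact_mod_cast hSa k
      have hgr : |(g : ℝ)| = 1 := by exact_mod_cast hga
      have h2 : |a * (S k * g) / (|(q : ℝ)| - 1)| ≤ |a| := by
        rw [abs_div, abs_mul, abs_mul, hgr, abs_of_nonneg (by linarith : 0 ≤ |(q : ℝ)| - 1),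
          div_le_iff₀ (by linarith)]
        have := mul_le_mul_of_nonneg_left hSr ha
        nlinarith
      have := abs_add_le (u k) (a * (S k * g) / (|(q : ℝ)| - 1))
      have := hub k
      simp only [hW]
      linarith
  · intro k
    have he : |p * s k - s (k + 1)| ≤ m - 1 := by
      have h1 := abs_le.mp (hsa k)
      have h2 := abs_le.mp (hsa (k + 1))
      rw [abs_le]
      constructor <;> nlinarith
    have hf : ∃ f : ℤ, |f| ≤ n - 1 ∧
        W k = q * (Nat.casesOn k z1 W : ℝ) - a * s k - f := by
      cases k with
      | zero =>
        refine ⟨f0, hf0, ?_⟩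
        show W 0 = q * z1 - a * z0 - f0
        simp only [hW, hu0, hS]
        push_cast
        have : a * (σ * g * g ^ 0 * g) / (|(q : ℝ)| - 1) = a * σ / (|(q : ℝ)| - 1) := by
          congr 1; linear_combination (a * σ) * hg1'
        rw [this]; ring
      | succ k => exact hWs k
    obtain ⟨f, hf1, hf2⟩ := hf
    refine ⟨p * s k - s (k + 1), f, he, hf1, ?_, hf2⟩
    push_cast
    ring

theorem cond1_iff (p q m n : ℤ) (a : ℝ) (hp : 4 ≤ p) (hq : 3 ≤ |q|)
    (hm1 : p + 1 < m) (hm2 : m < 2 * p - 1) (hn : |q| ≤ 2 * n - 1) :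
    (∃ l : ℤ, |l| ≤ n - 1 ∧ Orb p q m n a (1 : ℤ) l) ↔
      |a| ≤ (q : ℝ) ^ 2 * ((n : ℝ) - 1) / (|(q : ℝ)| - 2) := by
  have hq' : (3 : ℝ) ≤ |(q : ℝ)| := by exact_mod_cast hq
  have hn' : |(q : ℝ)| ≤ 2 * n - 1 := by exact_mod_cast hn
  have hqne : (q : ℝ) ≠ 0 := by intro h; rw [h] at hq'; norm_num at hq'
  rw [le_div_iff₀ (by linarith), ← sq_abs (q : ℝ)]
  constructor
  · rintro ⟨l, hl, h⟩
    obtain ⟨f, hf, h1⟩ := orb_nec p q m n a hp hq hm2 1 l h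
    have hl' : |(l : ℝ)| ≤ n - 1 := by exact_mod_cast hl
    have hf' : |(f : ℝ)| ≤ n - 1 := by exact_mod_cast hf
    have h2 : |a| ≤ |q * (l : ℝ) - a * (1 : ℤ) - f| + |(q : ℝ)| * |(l : ℝ)| + |(f : ℝ)| := by
      have e : a = -(q * (l : ℝ) - a * (1 : ℤ) - f) + q * l + -f := by push_cast; ring
      have e1 := abs_add_le (-(q * (l : ℝ) - a * (1 : ℤ) - f) + q * l) (-(f : ℝ))
      have e2 := abs_add_le (-(q * (l : ℝ) - a * (1 : ℤ) - f)) (q * (l : ℝ))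
      rw [← e, abs_neg (f : ℝ)] at e1
      rw [abs_neg, abs_mul] at e2
      linarith
    have h3 := mul_le_mul_of_nonneg_left hl' (abs_nonneg (q : ℝ))
    have h4 : |a| - |(q : ℝ)| * (n - 1) - (n - 1) ≤ |q * (l : ℝ) - a * (1 : ℤ) - f| := by linarith
    have h5 := mul_le_mul_of_nonneg_left h4 (by linarith : 0 ≤ |(q : ℝ)| - 1)
    nlinarith
  · intro h
    set Q := |(q : ℝ)| with hQ
    have hQ1 : Q - 1 ≠ 0 := by linarith
    have hY : |a * (Q - 2) / ((Q - 1) * q)| ≤ ((n - 1 : ℤ) : ℝ) + (n - 1) / (Q - 1) := by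
      rw [abs_div, abs_mul, abs_mul, abs_of_nonneg (by linarith : 0 ≤ Q - 2),
        abs_of_nonneg (by linarith : 0 ≤ Q - 1), ← hQ,
        div_le_iff₀ (mul_pos (by linarith) (by linarith))]
      push_cast
      have : ((n : ℝ) - 1 + (n - 1) / (Q - 1)) * ((Q - 1) * Q) = Q ^ 2 * (n - 1) := by
        field_simp; ring
      rw [this]; exact h
    obtain ⟨l, hl, hl2⟩ := cover (n - 1) (by omega) ((n - 1) / (Q - 1)) _
      (by rw [le_div_iff₀ (by linarith)]; linarith) hY
    refine ⟨l, hl, orb_suf p q m n a hp hq hm1 hn 1 (by norm_num) l (-1) (by norm_num) ?_⟩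
    rw [← hQ]
    have e : q * (l : ℝ) - a * ((1 : ℤ) : ℝ) - a * ((-1 : ℤ) : ℝ) / (Q - 1)
        = -q * (a * (Q - 2) / ((Q - 1) * q) - l) := by
      push_cast; field_simp; ring
    rw [e, abs_mul, abs_neg, ← hQ]
    have h6 := mul_le_mul_of_nonneg_left hl2 (by linarith : 0 ≤ Q)
    have h7 : Q * (((n : ℝ) - 1) / (Q - 1)) = n - 1 + (n - 1) / (Q - 1) := by field_simp; ring
    linarith

theorem cond2_nec (p q m n : ℤ) (a : ℝ) (hp : 4 ≤ p) (hq : 3 ≤ |q|)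
    (hm2 : m < 2 * p - 1) (h : Orb p q m n a (0 : ℤ) 1) :
    |(q : ℝ)| * (|(q : ℝ)| - n) ≤ |a| := by
  have hq' : (3 : ℝ) ≤ |(q : ℝ)| := by exact_mod_cast hq
  obtain ⟨f, hf, h1⟩ := orb_nec p q m n a hp hq hm2 0 1 h
  have hf' : |(f : ℝ)| ≤ n - 1 := by exact_mod_cast hf
  have e : (q : ℝ) * 1 - a * ((0 : ℤ) : ℝ) - f = q - f := by push_cast; ring
  rw [e] at h1
  have h2 := abs_sub_abs_le_abs_sub (q : ℝ) (f : ℝ)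
  have h4 : |(q : ℝ)| - (n - 1) ≤ |(q : ℝ) - f| := by linarith
  have h5 := mul_le_mul_of_nonneg_left h4 (by linarith : 0 ≤ |(q : ℝ)| - 1)
  nlinarith

theorem cond2_suf (p q m n : ℤ) (a : ℝ) (hp : 4 ≤ p) (hq : 3 ≤ |q|)
    (hm1 : p + 1 < m) (hn : |q| ≤ 2 * n - 1)
    (h1 : |(q : ℝ)| * (|(q : ℝ)| - n) ≤ |a|)
    (h2 : |a| ≤ (q : ℝ) ^ 2 * ((n : ℝ) - 1) / (|(q : ℝ)| - 2)) :
    Orb p q m n a (0 : ℤ) 1 := by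
  have hq' : (3 : ℝ) ≤ |(q : ℝ)| := by exact_mod_cast hq
  have hn' : |(q : ℝ)| ≤ 2 * n - 1 := by exact_mod_cast hn
  rw [le_div_iff₀ (by linarith), ← sq_abs (q : ℝ)] at h2
  have hQ1 : |(q : ℝ)| - 1 ≠ 0 := by linarith
  have hbd : ((n : ℝ) - 1 + (n - 1) / (|(q : ℝ)| - 1))
      = |(q : ℝ)| * (n - 1) / (|(q : ℝ)| - 1) := by
    field_simp; ring
  by_cases hc : |q| ≤ n
  · have hc' : |(q : ℝ)| ≤ n := by exact_mod_cast hc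
    refine orb_suf p q m n a hp hq hm1 hn 0 (by norm_num) 1 0 (by norm_num) ?_
    rw [hbd]
    simp only [Int.cast_zero, mul_zero, zero_div, sub_zero, mul_one]
    rw [le_div_iff₀ (by linarith)]
    nlinarith
  · push Not at hc
    have hc' : (n : ℝ) ≤ |(q : ℝ)| - 1 := by
      have : n ≤ |q| - 1 := by omega
      exact_mod_cast this
    have hup : |a| ≤ |(q : ℝ)| * (|(q : ℝ)| + n - 2) := by
      set Q := |(q : ℝ)|
      have h3 : 0 ≤ (Q - 2) * (Q - 3) := mul_nonneg (by linarith) (by linarith)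
      have h4 : Q * (n - 1) ≤ (Q - 2) * (Q + n - 2) := by nlinarith
      have h5 := mul_le_mul_of_nonneg_left h4 (by linarith : 0 ≤ Q)
      have h6 : (Q - 2) * |a| ≤ (Q - 2) * (Q * (Q + n - 2)) := by nlinarith
      exact le_of_mul_le_mul_left h6 (by linarith)
    obtain ⟨σ, hσ, hσ2⟩ : ∃ σ : ℤ, |σ| ≤ 1 ∧
        |(q : ℝ) - a * σ / (|(q : ℝ)| - 1)| = |(|(q : ℝ)| - |a| / (|(q : ℝ)| - 1))| := by
      have key : ∀ g τ : ℝ, g = 1 ∨ g = -1 → (q : ℝ) = g * |(q : ℝ)| → a * τ = g * |a| →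
          |(q : ℝ) - a * τ / (|(q : ℝ)| - 1)| = |(|(q : ℝ)| - |a| / (|(q : ℝ)| - 1))| := by
        intro g τ hg hq1 ha1
        have : (q : ℝ) - a * τ / (|(q : ℝ)| - 1)
            = g * (|(q : ℝ)| - |a| / (|(q : ℝ)| - 1)) := by
          rw [ha1, mul_sub, ← hq1, mul_div_assoc]
        rw [this, abs_mul]
        rcases hg with rfl | rfl <;> simp
      rcases abs_cases (q : ℝ) with hh | hh <;> rcases abs_cases a with hk | hk
      · exact ⟨1, by norm_num, key 1 _ (by simp) (by linarith) (by push_cast; linarith)⟩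
      · exact ⟨-1, by norm_num, key 1 _ (by simp) (by linarith) (by push_cast; linarith)⟩
      · exact ⟨-1, by norm_num, key (-1) _ (by simp) (by linarith) (by push_cast; linarith)⟩
      · exact ⟨1, by norm_num, key (-1) _ (by simp) (by linarith) (by push_cast; linarith)⟩
    refine orb_suf p q m n a hp hq hm1 hn 0 (by norm_num) 1 σ hσ ?_
    simp only [Int.cast_zero, mul_zero, sub_zero, mul_one]
    rw [hσ2, hbd]
    have e : |(q : ℝ)| - |a| / (|(q : ℝ)| - 1)
        = (|(q : ℝ)| * (|(q : ℝ)| - 1) - |a|) / (|(q : ℝ)| - 1) := by field_simp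
    rw [e, abs_div, abs_of_nonneg (by linarith : 0 ≤ |(q : ℝ)| - 1)]
    apply div_le_div_of_nonneg_right _ (by linarith : 0 ≤ |(q : ℝ)| - 1)
    rw [abs_le]
    constructor <;> nlinarith

theorem stmt_11 (p q m n : ℤ) (a : ℝ) (hp : 2 ≤ p) (hq : 3 ≤ |q|)
    (hm1 : p + 1 < m) (hm2 : m < 2 * p - 1) (hn : |q| ≤ 2 * n - 1) :
    ((∀ i ∈ Set.Icc (0 : ℤ) (m - 2),
        (Gi (matA p q a) (selfAffineSet (matA p q a) (digitSet m n)) n i ∩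
          Gi (matA p q a) (selfAffineSet (matA p q a) (digitSet m n)) n (i + 1)).Nonempty) ∧
      (∀ i ∈ Set.Icc (0 : ℤ) (m - 1), ∀ j ∈ Set.Icc (0 : ℤ) (n - 2),
        (Sij (matA p q a) (selfAffineSet (matA p q a) (digitSet m n)) i j ∩
          Sij (matA p q a) (selfAffineSet (matA p q a) (digitSet m n)) i (j + 1)).Nonempty)) ↔
    ((|q| : ℝ) * ((|q| : ℝ) - (n : ℝ)) ≤ |a| ∧
      |a| ≤ (q : ℝ) ^ 2 * ((n : ℝ) - 1) / ((|q| : ℝ) - 2)) := by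
  have hp4 : 4 ≤ p := by omega
  have hc1 : (∀ i ∈ Set.Icc (0 : ℤ) (m - 2),
        (Gi (matA p q a) (selfAffineSet (matA p q a) (digitSet m n)) n i ∩
          Gi (matA p q a) (selfAffineSet (matA p q a) (digitSet m n)) n (i + 1)).Nonempty) ↔
      ∃ l : ℤ, |l| ≤ n - 1 ∧ Orb p q m n a (1 : ℤ) l := by
    constructor
    · intro h
      obtain ⟨x, hx1, hx2⟩ := h 0 ⟨le_refl _, by omega⟩
      simp only [Gi, Set.mem_iUnion] at hx1 hx2
      obtain ⟨j, hj, hx1⟩ := hx1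
      obtain ⟨j', hj', hx2⟩ := hx2
      have := (S_iff p q m n a hp4 hq _ _ _ _).mp ⟨x, hx1, hx2⟩
      refine ⟨j' - j, ?_, ?_⟩
      · rw [Set.mem_Icc] at hj hj'
        rw [abs_le]; omega
      · convert this using 1 <;> push_cast <;> ring
    · rintro ⟨l, hl, h⟩ i hi
      obtain ⟨j', j, h1, h2, h3, h4, h5⟩ := split_digit n l hl
      have hS := (S_iff p q m n a hp4 hq i j (i + 1) j').mpr (by
        have h5' : (j' : ℝ) - j = l := by exact_mod_cast h5
        rw [h5']
        convert h using 1; push_cast; ring)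
      obtain ⟨x, hx1, hx2⟩ := hS
      refine ⟨x, ?_, ?_⟩
      · exact Set.mem_biUnion (x := j) ⟨h3, h4⟩ hx1
      · exact Set.mem_biUnion (x := j') ⟨h1, h2⟩ hx2
  have hc2 : (∀ i ∈ Set.Icc (0 : ℤ) (m - 1), ∀ j ∈ Set.Icc (0 : ℤ) (n - 2),
        (Sij (matA p q a) (selfAffineSet (matA p q a) (digitSet m n)) i j ∩
          Sij (matA p q a) (selfAffineSet (matA p q a) (digitSet m n)) i (j + 1)).Nonempty) ↔
      Orb p q m n a (0 : ℤ) 1 := by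
    have key : ∀ i j : ℤ, (Sij (matA p q a) (selfAffineSet (matA p q a) (digitSet m n)) i j ∩
          Sij (matA p q a) (selfAffineSet (matA p q a) (digitSet m n)) i (j + 1)).Nonempty ↔
        Orb p q m n a (0 : ℤ) 1 := by
      intro i j
      rw [S_iff p q m n a hp4 hq]
      have e1 : (i : ℝ) - i = ((0 : ℤ) : ℝ) := by simp
      have e2 : ((j + 1 : ℤ) : ℝ) - j = 1 := by push_cast; ring
      rw [e1, e2]
    constructor
    · intro h
      exact (key 0 0).mp (h 0 ⟨le_refl _, by omega⟩ 0 ⟨le_refl _, by omega⟩)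
    · intro h i _ j _
      exact (key i j).mpr h
  rw [hc1, hc2, cond1_iff p q m n a hp4 hq hm1 hm2 hn]
  constructor
  · rintro ⟨h1, h2⟩
    exact ⟨cond2_nec p q m n a hp4 hq hm2 h2, h1⟩
  · rintro ⟨h1, h2⟩
    exact ⟨h2, cond2_suf p q m n a hp4 hq hm1 hn h1 h2⟩
end

section
/- Let p, q, m, n be integers with |p| ≥ 2, |q| ≥ 2, m, n ≥ 1, mn = |pq|, m > |p|, and 2n − 1 ≥ |q|, and let a be a nonzero integer. Then the self-affine set T(A, D) is not a tile of ℝ²: there is no discrete set J ⊆ ℝ² such that ⋃_{t ∈ J} (T + t) = ℝ² and (T° + t) ∩ (T° + s) = ∅ for all distinct s, t ∈ J, where T° denotes the interior of T. -/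
open Matrix

/-- The expanding matrix with rows `(p, 0)` and `(a, q)`. -/
noncomputable def matB (p q : ℤ) (a : ℝ) : Matrix (Fin 2) (Fin 2) ℝ :=
  !![(p : ℝ), 0; a, (q : ℝ)]

/-- `T` is a tile of `ℝ²`: there is a discrete set `J` whose translates of `T` cover `ℝ²`
with pairwise disjoint interiors. -/
def IsTile (T : Set (Fin 2 → ℝ)) : Prop :=
  ∃ J : Set (Fin 2 → ℝ), DiscreteTopology J ∧
    (⋃ t ∈ J, (fun x => x + t) '' T) = Set.univ ∧
    ∀ s ∈ J, ∀ t ∈ J, s ≠ t →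
      ((fun x => x + s) '' interior T) ∩ ((fun x => x + t) '' interior T) = ∅

/-- Every integer has a base-`q` expansion with digits in `[-(n-1), n-1]`. -/
lemma exists_rep (q n : ℤ) (hq : 2 ≤ |q|) (hn2 : 2 ≤ n) (hnq : |q| ≤ 2 * n - 1)
    (hlt : n < |q|) (c : ℕ) : ∀ N : ℤ, N.natAbs ≤ c →
    ∃ (L : ℕ) (y : ℕ → ℤ), (∀ j, |y j| ≤ n - 1) ∧ ∀ L', L ≤ L' →
      ∑ j ∈ Finset.range L', q ^ j * y j = N := by
  induction c with
  | zero =>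
    intro N hN
    have : N = 0 := by omega
    subst this
    exact ⟨0, fun _ => 0, fun j => by simp; omega, by simp⟩
  | succ c ih =>
    intro N hN
    have hq3 : 3 ≤ |q| := by omega
    -- a residue
    obtain ⟨r, N', hr, hN'⟩ : ∃ r N' : ℤ, |r| ≤ n - 1 ∧ 2 * |r| ≤ |q| ∧ N = q * N' + r := by
      have h0 : 0 ≤ N % q := Int.emod_nonneg _ (by intro h; simp [h] at hq)
      have h1 : N % q < |q| := Int.emod_lt_abs _ (by intro h; simp [h] at hq)
      have h2 := Int.mul_ediv_add_emod N q
      by_cases h : 2 * (N % q) ≤ |q|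
      · refine ⟨N % q, N / q, ?_, ?_, h2.symm⟩
        · rw [abs_of_nonneg h0]; omega
        · rw [abs_of_nonneg h0]; omega
      · have h3 : q * q.sign = |q| := Int.mul_sign_self q ▸ (Int.natCast_natAbs q)
        refine ⟨N % q - |q|, N / q + q.sign, ?_, ?_, ?_⟩
        · rw [abs_of_nonpos (by omega)]; omega
        · rw [abs_of_nonpos (by omega)]; omega
        · rw [mul_add, h3]; omega
    obtain ⟨hr2, hN'⟩ := hN'
    have hb : N'.natAbs ≤ c := by
      by_contra hcon
      push Not at hcon
      have e1 : |q| * |N'| ≤ |N| + |r| := by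
        rw [← abs_mul]
        have : q * N' = N - r := by omega
        rw [this]
        exact abs_sub N r
      have e2 : |N| ≤ c + 1 := by rw [Int.abs_eq_natAbs]; exact_mod_cast hN
      have e3 : (c : ℤ) + 1 ≤ |N'| := by rw [Int.abs_eq_natAbs]; exact_mod_cast hcon
      nlinarith
    obtain ⟨L, y, hy, hs⟩ := ih N' hb
    refine ⟨L + 1, fun j => Nat.casesOn j r y, ?_, ?_⟩
    · intro j
      cases j with
      | zero => exact hr
      | succ j => exact hy j
    · intro L' hL'
      obtain ⟨M, rfl⟩ : ∃ M, L' = M + 1 := ⟨L' - 1, by omega⟩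
      rw [Finset.sum_range_succ']
      simp only [pow_succ, pow_zero, one_mul]
      rw [hN', ← hs M (by omega), Finset.mul_sum]
      congr 1
      apply Finset.sum_congr rfl
      intro j _
      ring

lemma matB_det (p q : ℤ) (a : ℝ) : (matB p q a).det = (p : ℝ) * q := by
  simp [matB, Matrix.det_fin_two]

lemma matB_mulVec (p q : ℤ) (a u v : ℝ) :
    (matB p q a) *ᵥ ![u, v] = ![p * u, a * u + q * v] := by
  ext i; fin_cases i <;> simp [matB, Matrix.mulVec, dotProduct]

lemma matB_pow_mulVec (p q : ℤ) (a c : ℝ) (j : ℕ) :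
    ((matB p q a) ^ j) *ᵥ ![0, c] = ![0, (q : ℝ) ^ j * c] := by
  induction j with
  | zero => simp
  | succ j ih =>
    rw [pow_succ', ← Matrix.mulVec_mulVec, ih, matB_mulVec]
    ext i; fin_cases i <;> simp <;> ring

/-- A nontrivial vanishing combination of powers. -/
lemma exists_coincidence (p q m n a : ℤ) (hq : 2 ≤ |q|) (hmp : |p| < m) (hp : 2 ≤ |p|)
    (hn2 : 2 ≤ n) (hnq : |q| ≤ 2 * n - 1) (hlt : n < |q|) :
    ∃ (K : ℕ) (x y : ℕ → ℤ), 2 ≤ K ∧ x 1 = 1 ∧ (∀ j, |x j| ≤ m - 1) ∧ (∀ j, |y j| ≤ n - 1) ∧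
      ∑ j ∈ Finset.range K, ((matB p q (a : ℝ)) ^ j) *ᵥ ![(x j : ℝ), (y j : ℝ)] = 0 := by
  obtain ⟨L, y, hy, hs⟩ := exists_rep q n hq hn2 hnq hlt _ (-a) le_rfl
  refine ⟨L + 2, fun j => if j = 0 then -p else if j = 1 then 1 else 0, y, by omega, by simp,
    ?_, hy, ?_⟩
  · intro j
    dsimp only
    split_ifs
    · rw [abs_neg]; omega
    · rw [abs_one]; omega
    · rw [abs_zero]; omega
  · have h1 : ∀ j : ℕ, (![((if j = 0 then -p else if j = 1 then 1 else 0 : ℤ) : ℝ), (y j : ℝ)] :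
        Fin 2 → ℝ) = ![((if j = 0 then -p else if j = 1 then 1 else 0 : ℤ) : ℝ), 0] +
          ![0, (y j : ℝ)] := by
      intro j; ext i; fin_cases i <;> simp
    simp only [h1, Matrix.mulVec_add, Finset.sum_add_distrib, matB_pow_mulVec]
    have h2 : ∑ j ∈ Finset.range (L + 2), (![0, (q : ℝ) ^ j * (y j : ℝ)] : Fin 2 → ℝ)
        = ![0, -(a : ℝ)] := by
      have := congrArg (fun z : ℤ => (z : ℝ)) (hs (L + 2) (by omega))
      push_cast at this
      ext i; fin_cases i
      · simp [Finset.sum_apply]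
      · simp only [Finset.sum_apply]; simpa using this
    rw [h2, Finset.sum_range_succ', Finset.sum_range_succ']
    have h3 : ∑ k ∈ Finset.range L, (matB p q (a : ℝ)) ^ (k + 1 + 1) *ᵥ
        (![((if k + 1 + 1 = 0 then -p else if k + 1 + 1 = 1 then 1 else 0 : ℤ) : ℝ), 0] :
          Fin 2 → ℝ) = 0 := by
      apply Finset.sum_eq_zero
      intro k _
      have : (![((if k + 1 + 1 = 0 then -p else if k + 1 + 1 = 1 then 1 else 0 : ℤ) : ℝ), 0] :
          Fin 2 → ℝ) = 0 := by
        ext i; fin_cases i <;> simp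
      rw [this, Matrix.mulVec_zero]
    rw [h3]
    simp only [zero_add, pow_one, pow_zero, Matrix.one_mulVec, matB_mulVec]
    ext i; fin_cases i <;> simp

lemma matB_inv_mulVec (p q : ℤ) (a u v : ℝ) (hp : p ≠ 0) (hq : q ≠ 0) :
    (matB p q a)⁻¹ *ᵥ ![u, v] = ![u / p, (v - a * (u / p)) / q] := by
  have hp' : (p : ℝ) ≠ 0 := by exact_mod_cast hp
  have hq' : (q : ℝ) ≠ 0 := by exact_mod_cast hq
  have hu : IsUnit (matB p q a).det := by
    rw [matB_det]; exact (mul_ne_zero hp' hq').isUnit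
  have : (![u, v] : Fin 2 → ℝ) = (matB p q a) *ᵥ ![u / p, (v - a * (u / p)) / q] := by
    rw [matB_mulVec]
    ext i; fin_cases i
    · simp; field_simp
    · simp; field_simp; ring
  rw [this, Matrix.mulVec_mulVec, Matrix.nonsing_inv_mul _ hu, Matrix.one_mulVec]

lemma selfAffine_bounded (p q m n : ℤ) (a : ℝ) (hp : 2 ≤ |p|) (hq : 2 ≤ |q|)
    (hm : 1 ≤ m) (hn : 1 ≤ n) :
    ∃ R1 R2 : ℝ, selfAffineSet (matB p q a) (digitSet m n) ⊆
      Set.Icc ![-R1, -R2] ![R1, R2] := by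
  have hp0 : p ≠ 0 := by intro h; simp [h] at hp
  have hq0 : q ≠ 0 := by intro h; simp [h] at hq
  have hpR : (2 : ℝ) ≤ |(p : ℝ)| := by exact_mod_cast hp
  have hqR : (2 : ℝ) ≤ |(q : ℝ)| := by exact_mod_cast hq
  have hmR : (1 : ℝ) ≤ m := by exact_mod_cast hm
  have hnR : (1 : ℝ) ≤ n := by exact_mod_cast hn
  refine ⟨m, n + |a| * m, ?_⟩
  have key : ∀ (K : ℕ) (d : ℕ → Fin 2 → ℝ), (∀ k, d k ∈ digitSet m n) →
      |(∑ k ∈ Finset.range K, ((matB p q a)⁻¹ ^ (k + 1)) *ᵥ d k) 0| ≤ m ∧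
      |(∑ k ∈ Finset.range K, ((matB p q a)⁻¹ ^ (k + 1)) *ᵥ d k) 1| ≤ n + |a| * m := by
    intro K
    induction K with
    | zero => intro d _; simp; constructor <;> positivity
    | succ K ih =>
      intro d hd
      obtain ⟨i1, i2⟩ := ih (fun k => d (k + 1)) (fun k => hd _)
      have e : ∑ k ∈ Finset.range (K + 1), ((matB p q a)⁻¹ ^ (k + 1)) *ᵥ d k =
          (matB p q a)⁻¹ *ᵥ
            (∑ k ∈ Finset.range K, ((matB p q a)⁻¹ ^ (k + 1)) *ᵥ d (k + 1) + d 0) := by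
        rw [Finset.sum_range_succ', Matrix.mulVec_add, Matrix.mulVec_sum]
        simp only [Matrix.mulVec_mulVec, ← pow_succ', zero_add, pow_one]
      rw [e]
      set X := ∑ k ∈ Finset.range K, ((matB p q a)⁻¹ ^ (k + 1)) *ᵥ d (k + 1)
      obtain ⟨i, j, hi0, hi1, hj0, hj1, hd0⟩ := hd 0
      have e2 : X + d 0 = ![X 0 + i, X 1 + j] := by
        rw [hd0]; ext t; fin_cases t <;> simp
      rw [e2, matB_inv_mulVec p q a _ _ hp0 hq0]
      have hi0' : (0 : ℝ) ≤ i := by exact_mod_cast hi0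
      have hj0' : (0 : ℝ) ≤ j := by exact_mod_cast hj0
      have hi1' : (i : ℝ) ≤ m - 1 := by exact_mod_cast hi1
      have hj1' : (j : ℝ) ≤ n - 1 := by exact_mod_cast hj1
      have b1 : |(X 0 + i) / (p : ℝ)| ≤ m := by
        rw [abs_div, div_le_iff₀ (by linarith)]
        have := abs_add_le (X 0) (i : ℝ)
        rw [abs_of_nonneg hi0'] at this
        nlinarith
      refine ⟨by simpa using b1, ?_⟩
      have b2 : |(X 1 + j - a * ((X 0 + i) / (p : ℝ))) / (q : ℝ)| ≤ n + |a| * m := by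
        rw [abs_div, div_le_iff₀ (by linarith)]
        have h1 := abs_sub (X 1 + j) (a * ((X 0 + i) / (p : ℝ)))
        have h2 := abs_add_le (X 1) (j : ℝ)
        rw [abs_of_nonneg hj0'] at h2
        rw [abs_mul] at h1
        have h3 := mul_le_mul_of_nonneg_left b1 (abs_nonneg a)
        have h4 : 0 ≤ |a| * (m : ℝ) := by positivity
        nlinarith
      simpa using b2
  rintro x ⟨d, hd, hx⟩
  have ht := hx.tendsto_sum_nat
  refine isClosed_Icc.mem_of_tendsto ht (Filter.Eventually.of_forall fun K => ?_)
  obtain ⟨k1, k2⟩ := key K d hd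
  rw [abs_le] at k1 k2
  constructor
  · intro i; fin_cases i
    · exact k1.1
    · simpa using k2.1
  · intro i; fin_cases i
    · exact k1.2
    · exact k2.2

open MeasureTheory in
lemma selfAffine_null (p q m n a : ℤ) (hp : 2 ≤ |p|) (hq : 2 ≤ |q|)
    (hm : 1 ≤ m) (hn : 1 ≤ n) (hmn : m * n = |p * q|) (hmp : |p| < m)
    (hnq : |q| ≤ 2 * n - 1) :
    volume (selfAffineSet (matB p q (a : ℝ)) (digitSet m n)) = 0 := by
  have hp0 : p ≠ 0 := by intro h; simp [h] at hp
  have hq0 : q ≠ 0 := by intro h; simp [h] at hq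
  have hn2 : 2 ≤ n := by omega
  have hlt : n < |q| := by
    rw [abs_mul] at hmn
    by_contra h
    push Not at h
    nlinarith
  obtain ⟨K, x, y, hK, hx1, hx, hy, hsum⟩ :=
    exists_coincidence p q m n a hq hmp hp hn2 hnq hlt
  obtain ⟨R1, R2, hR⟩ := selfAffine_bounded p q m n a hp hq hm hn
  set A := matB p q (a : ℝ) with hA
  set T := selfAffineSet A (digitSet m n) with hT
  have hdet : A.det = (p : ℝ) * q := matB_det p q a
  have hu : IsUnit A.det := by
    rw [hdet]
    exact (mul_ne_zero (by exact_mod_cast hp0) (by exact_mod_cast hq0)).isUnit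
  have hAB : A * A⁻¹ = 1 := Matrix.mul_nonsing_inv _ hu
  have hBA : A⁻¹ * A = 1 := Matrix.nonsing_inv_mul _ hu
  have hcomm : Commute A A⁻¹ := by rw [Commute, SemiconjBy, hAB, hBA]
  have hABk : ∀ k, A ^ k * A⁻¹ ^ k = 1 := fun k => by rw [← hcomm.mul_pow, hAB, one_pow]
  have hBAk : ∀ k, A⁻¹ ^ k * A ^ k = 1 := fun k => by rw [← hcomm.symm.mul_pow, hBA, one_pow]
  have hfin : volume T ≠ ⊤ := by
    apply ne_top_of_le_ne_top _ (measure_mono hR)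
    exact (isCompact_Icc).measure_lt_top.ne
  -- words
  obtain ⟨m', rfl⟩ : ∃ m' : ℕ, m = m' := ⟨m.toNat, by omega⟩
  obtain ⟨n', rfl⟩ : ∃ n' : ℕ, n = n' := ⟨n.toNat, by omega⟩
  let dv : Fin m' × Fin n' → (Fin 2 → ℝ) := fun c => ![((c.1 : ℕ) : ℝ), ((c.2 : ℕ) : ℝ)]
  let v : (Fin K → Fin m' × Fin n') → (Fin 2 → ℝ) :=
    fun w => ∑ k : Fin K, (A⁻¹ ^ ((k : ℕ) + 1)) *ᵥ dv (w k)
  classical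
  let S : Finset (Fin 2 → ℝ) := Finset.univ.image v
  have hninj : ¬ Function.Injective v := by
    intro hinj
    let w1 : Fin K → Fin m' × Fin n' := fun k =>
      (⟨(x (K - 1 - k)).toNat, by have := abs_le.1 (hx (K - 1 - k)); omega⟩,
       ⟨(y (K - 1 - k)).toNat, by have := abs_le.1 (hy (K - 1 - k)); omega⟩)
    let w2 : Fin K → Fin m' × Fin n' := fun k =>
      (⟨(-x (K - 1 - k)).toNat, by have := abs_le.1 (hx (K - 1 - k)); omega⟩,
       ⟨(-y (K - 1 - k)).toNat, by have := abs_le.1 (hy (K - 1 - k)); omega⟩)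
    have hw : v w1 = v w2 := by
      rw [← sub_eq_zero]
      have hposneg : ∀ z : ℤ, ((z.toNat : ℕ) : ℝ) - (((-z).toNat : ℕ) : ℝ) = z := by
        intro z
        have : (z.toNat : ℤ) - ((-z).toNat : ℤ) = z := by omega
        exact_mod_cast this
      have hdiff : ∀ k : Fin K, dv (w1 k) - dv (w2 k) =
          ![(x (K - 1 - k) : ℝ), (y (K - 1 - k) : ℝ)] := by
        intro k
        ext i; fin_cases i
        · exact hposneg _
        · exact hposneg _
      simp only [v, ← Finset.sum_sub_distrib, ← Matrix.mulVec_sub, hdiff]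
      rw [Fin.sum_univ_eq_sum_range (fun k => (A⁻¹ ^ (k + 1)) *ᵥ
        (![(x (K - 1 - k) : ℝ), (y (K - 1 - k) : ℝ)] : Fin 2 → ℝ)) K,
        ← Finset.sum_range_reflect]
      have := congrArg (fun z => A⁻¹ ^ K *ᵥ z) hsum
      simp only [Matrix.mulVec_sum, Matrix.mulVec_zero, Matrix.mulVec_mulVec] at this
      rw [← this]
      apply Finset.sum_congr rfl
      intro j hj
      have hj' := Finset.mem_range.1 hj
      have e1 : K - 1 - (K - 1 - j) = j := by omega
      have e2 : K = (K - 1 - j + 1) + j := by omega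
      rw [e1]
      congr 1
      conv_rhs => rw [e2, pow_add, mul_assoc]
      rw [hBAk, mul_one]
    have h := congrFun (hinj hw) ⟨K - 2, by omega⟩
    have h1 := congrArg (fun c => (c.1 : ℕ)) h
    have e : K - 1 - (K - 2) = 1 := by omega
    simp [w1, w2, e, hx1] at h1
  have hcard : S.card < (m' * n') ^ K := by
    have h1 : S.card ≤ (Finset.univ : Finset (Fin K → Fin m' × Fin n')).card :=
      Finset.card_image_le
    have h2 : S.card ≠ (Finset.univ : Finset (Fin K → Fin m' × Fin n')).card := by
      intro h
      exact hninj (by simpa using Finset.card_image_iff.1 h)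
    have h3 := lt_of_le_of_ne h1 h2
    simpa using h3
  have hsub : T ⊆ ⋃ s ∈ S, (fun z => s + z) '' (Matrix.toLin' (A⁻¹ ^ K) '' T) := by
    rintro z ⟨d, hd, hz⟩
    have hd' : ∀ k, ∃ c : Fin m' × Fin n', d k = dv c := by
      intro k
      obtain ⟨i, j, h1, h2, h3, h4, h5⟩ := hd k
      obtain ⟨i', rfl⟩ : ∃ i' : ℕ, i = i' := ⟨i.toNat, by omega⟩
      obtain ⟨j', rfl⟩ : ∃ j' : ℕ, j = j' := ⟨j.toNat, by omega⟩
      exact ⟨(⟨i', by omega⟩, ⟨j', by omega⟩), by simpa [dv] using h5⟩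
    choose c hc using hd'
    have hv : v (fun k => c k) = ∑ k ∈ Finset.range K, (A⁻¹ ^ (k + 1)) *ᵥ d k := by
      simp only [v, ← hc]
      rw [Fin.sum_univ_eq_sum_range (fun k => (A⁻¹ ^ (k + 1)) *ᵥ d k) K]
    simp only [Set.mem_iUnion]
    refine ⟨v (fun k => c k), Finset.mem_image_of_mem _ (Finset.mem_univ _),
      z - v (fun k => c k), ⟨A ^ K *ᵥ (z - v (fun k => c k)), ?_, ?_⟩, by simp⟩
    · refine ⟨fun k => d (k + K), fun k => hd _, ?_⟩
      have h1 := (hasSum_nat_add_iff' K).2 hz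
      rw [← hv] at h1
      have h2 := h1.mapL (LinearMap.toContinuousLinearMap (Matrix.toLin' (A ^ K)))
      simp only [LinearMap.coe_toContinuousLinearMap', Matrix.toLin'_apply] at h2
      have h3 : (fun k => A⁻¹ ^ (k + 1) *ᵥ d (k + K)) =
          fun b => A ^ K *ᵥ A⁻¹ ^ (b + K + 1) *ᵥ d (b + K) := by
        funext k
        rw [Matrix.mulVec_mulVec]
        congr 1
        rw [show k + K + 1 = K + (k + 1) by ring, pow_add _ K, ← mul_assoc, hABk, one_mul]
      rw [← h3] at h2
      exact h2
    · rw [Matrix.toLin'_apply, Matrix.mulVec_mulVec, hBAk, Matrix.one_mulVec]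
  have hle : volume T ≤ S.card * (ENNReal.ofReal (|(A⁻¹ ^ K).det|) * volume T) := by
    refine (measure_mono hsub).trans ((measure_biUnion_finset_le _ _).trans ?_)
    rw [← nsmul_eq_mul, ← Finset.sum_const]
    apply Finset.sum_le_sum
    intro s _
    rw [Set.image_add_left, measure_preimage_add, Measure.addHaar_image_linearMap,
      LinearMap.det_toLin']
  have hdetK : |(A⁻¹ ^ K).det| = (((m' * n' : ℕ) : ℝ) ^ K)⁻¹ := by
    rw [Matrix.det_pow, Matrix.det_nonsing_inv, Ring.inverse_eq_inv', hdet, abs_pow, abs_inv,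
      inv_pow]
    congr 2
    have := congrArg (fun z : ℤ => (z : ℝ)) hmn
    push_cast at this ⊢
    rw [this]
  by_contra hne
  have hpos : 0 < (volume T).toReal := ENNReal.toReal_pos hne hfin
  have hle2 := ENNReal.toReal_mono (by finiteness) hle
  rw [ENNReal.toReal_mul, ENNReal.toReal_mul, ENNReal.toReal_ofReal (abs_nonneg _), hdetK,
    ENNReal.toReal_natCast] at hle2
  have hc2 : (S.card : ℝ) < ((m' * n' : ℕ) : ℝ) ^ K := by exact_mod_cast hcard
  have hP : (0 : ℝ) < ((m' * n' : ℕ) : ℝ) ^ K := lt_of_le_of_lt (by positivity) hc2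
  have : (S.card : ℝ) * (((m' * n' : ℕ) : ℝ) ^ K)⁻¹ < 1 := by
    rw [← div_eq_mul_inv, div_lt_one hP]; exact hc2
  nlinarith

open MeasureTheory in
lemma main_aux (p q m n a : ℤ) (hp : 2 ≤ |p|) (hq : 2 ≤ |q|)
    (hm : 1 ≤ m) (hn : 1 ≤ n) (hmn : m * n = |p * q|) (hmp : |p| < m)
    (hnq : |q| ≤ 2 * n - 1) (_ha : a ≠ 0) :
    ¬ IsTile (selfAffineSet (matB p q (a : ℝ)) (digitSet m n)) := by
  rintro ⟨J, hJ, hcov, -⟩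
  have h0 := selfAffine_null p q m n a hp hq hm hn hmn hmp hnq
  have hJc : J.Countable := by
    have : Countable J := countable_of_Lindelof_of_discrete
    exact Set.to_countable J
  have h1 : volume (⋃ t ∈ J, (fun x => x + t) ''
      (selfAffineSet (matB p q (a : ℝ)) (digitSet m n))) = 0 := by
    rw [measure_biUnion_null_iff hJc]
    intro t _
    rw [Set.image_add_right, measure_preimage_add_right, h0]
  rw [hcov] at h1
  exact (NeZero.ne (volume : Measure (Fin 2 → ℝ))) (Measure.measure_univ_eq_zero.1 h1)

theorem stmt_17 (p q m n a : ℤ) (hp : 2 ≤ |p|) (hq : 2 ≤ |q|)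
    (hm : 1 ≤ m) (hn : 1 ≤ n) (hmn : m * n = |p * q|) (hmp : |p| < m)
    (hnq : |q| ≤ 2 * n - 1) (ha : a ≠ 0) :
    ¬ IsTile (selfAffineSet (matB p q (a : ℝ)) (digitSet m n)) := by
  exact main_aux p q m n a hp hq hm hn hmn hmp hnq ha
end
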